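/- arXiv:1607.00979 — 3 statements merged into one kernel-verified Lean document; each statement's English description precedes it below -/
import Mathlib

section
/- Let d ≥ 2 and γ ∈ (−1,∞)^d be fixed. Then there exist constants 0 < c₁ ≤ c₂ (depending only on d and γ) such that for every ξ ∈ S^{d−1}_+ and every 0 < r ≤ 2π, c₁ r^{d−1} ∏_{i=1}^d (ξ_i + r)^{γ_i} ≤ ∫_{c⁺(ξ,r)} w^γ dσ(w) ≤ c₂ r^{d−1} ∏_{i=1}^d (ξ_i + r)^{γ_i}. -/
open MeasureTheory

lemma aux_rpow_le {a b K g : ℝ} (ha : 0 < a) (hb : 0 < b) (hK : 1 ≤ K) (h1 : a ≤ K * b)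
    (h2 : b ≤ K * a) : a ^ g ≤ K ^ |g| * b ^ g := by
  have hK0 : 0 < K := by linarith
  rcases le_total 0 g with hg | hg
  · rw [abs_of_nonneg hg, ← Real.mul_rpow hK0.le hb.le]
    exact Real.rpow_le_rpow ha.le h1 hg
  · rw [abs_of_nonpos hg, Real.rpow_neg hK0.le, ← Real.inv_rpow hK0.le,
      ← Real.mul_rpow (inv_nonneg.2 hK0.le) hb.le]
    refine Real.rpow_le_rpow_of_nonpos (by positivity) ?_ hg
    rw [inv_mul_le_iff₀ hK0]; exact h2

lemma aux_lintegral_prod (n : ℕ) (h : Fin n → ℝ → ENNReal) (hm : ∀ k, Measurable (h k)) :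
    ∫⁻ x : Fin n → ℝ, ∏ k, h k (x k) = ∏ k, ∫⁻ t, h k t := by
  induction n with
  | zero => simp [volume_pi, Measure.pi_univ]
  | succ n ih =>
    have := (volume_preserving_piFinSuccAbove (fun _ : Fin (n+1) => ℝ) 0).symm
    rw [← this.lintegral_comp (by fun_prop), Fin.prod_univ_succ, ← ih _ (fun k => hm _)]
    simp only [Fin.prod_univ_succ]
    rw [Measure.volume_eq_prod, ← lintegral_prod_mul (hm 0).aemeasurable
      (Finset.measurable_prod _ fun k _ => (hm k.succ).comp (measurable_pi_apply k)).aemeasurable]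
    simp [MeasurableEquiv.piFinSuccAbove]

lemma aux_1d {g : ℝ} (hg : -1 < g) : ∃ C : ℝ, 0 < C ∧ ∀ ξ r : ℝ, 0 < ξ → 0 < r →
    ∫⁻ t, (Set.Ioo (max 0 (ξ - r)) (ξ + r)).indicator (fun t => ENNReal.ofReal (t ^ g)) t
      ≤ ENNReal.ofReal (C * (r * (ξ + r) ^ g)) := by
  refine ⟨max (2 * 4 ^ |g|) (3 / (g + 1)), by positivity, fun ξ r hξ hr => ?_⟩
  rw [lintegral_indicator measurableSet_Ioo]
  have hp : 0 < r * (ξ + r) ^ g := by positivity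
  rcases le_total (2 * r) ξ with h | h
  · calc _ ≤ ∫⁻ t in Set.Ioo (max 0 (ξ - r)) (ξ + r), ENNReal.ofReal (4 ^ |g| * (ξ + r) ^ g) := by
          refine setLIntegral_mono' measurableSet_Ioo fun t ht => ENNReal.ofReal_le_ofReal ?_
          have h1 := ht.1
          have h2 := ht.2
          rw [max_lt_iff] at h1
          exact aux_rpow_le h1.1 (by positivity) (by norm_num) (by linarith) (by linarith)
      _ ≤ ENNReal.ofReal (4 ^ |g| * (ξ + r) ^ g) * ENNReal.ofReal (2 * r) := by
          rw [setLIntegral_const, Real.volume_Ioo]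
          gcongr
          have := le_max_right 0 (ξ - r)
          linarith
      _ = ENNReal.ofReal (2 * 4 ^ |g| * (r * (ξ + r) ^ g)) := by
          rw [← ENNReal.ofReal_mul (by positivity)]; ring_nf
      _ ≤ _ := by
          apply ENNReal.ofReal_le_ofReal
          gcongr
          exact le_max_left _ _
  · have hg1 : 0 < g + 1 := by linarith
    have hs : 0 < ξ + r := by linarith
    calc _ ≤ ∫⁻ t in Set.Ioc 0 (ξ + r), ENNReal.ofReal (t ^ g) := by
          apply lintegral_mono_set
          intro t ht
          exact ⟨(max_lt_iff.1 ht.1).1, ht.2.le⟩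
      _ = ENNReal.ofReal (∫ t in (0:ℝ)..(ξ + r), t ^ g) := by
          rw [intervalIntegral.integral_of_le hs.le, ofReal_integral_eq_lintegral_ofReal]
          · exact (intervalIntegrable_iff_integrableOn_Ioc_of_le hs.le).1
              (intervalIntegral.intervalIntegrable_rpow' hg)
          · refine (ae_restrict_iff' measurableSet_Ioc).2 (Filter.Eventually.of_forall ?_)
            intro t ht
            exact Real.rpow_nonneg ht.1.le _
      _ ≤ _ := by
          apply ENNReal.ofReal_le_ofReal
          rw [integral_rpow (Or.inl hg), Real.zero_rpow hg1.ne', Real.rpow_add_one hs.ne', sub_zero]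
          calc (ξ + r) ^ g * (ξ + r) / (g + 1) ≤ (ξ + r) ^ g * (3 * r) / (g + 1) := by
                gcongr; linarith
            _ = 3 / (g + 1) * (r * (ξ + r) ^ g) := by ring
            _ ≤ _ := by gcongr; exact le_max_right _ _

def auxP {n : ℕ} (j : Fin (n+1)) (w : EuclideanSpace ℝ (Fin (n+1))) : Fin n → ℝ :=
  fun k => w (j.succAbove k)

lemma auxP_lip {n : ℕ} (j : Fin (n+1)) : LipschitzWith 1 (auxP j) := by
  refine LipschitzWith.of_dist_le_mul fun w v => ?_
  rw [NNReal.coe_one, one_mul, dist_pi_le_iff dist_nonneg]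
  intro k
  have := PiLp.norm_apply_le (w - v) (j.succAbove k)
  simpa [auxP, dist_eq_norm] using this

lemma aux_sq {n : ℕ} {w : EuclideanSpace ℝ (Fin n)} (hw : ‖w‖ = 1) : ∑ i, w i ^ 2 = 1 := by
  rw [← EuclideanSpace.real_norm_sq_eq, hw]; norm_num

lemma aux_abs_le {n : ℕ} {w : EuclideanSpace ℝ (Fin n)} (hw : ‖w‖ = 1) (i) : |w i| ≤ 1 := by
  have := PiLp.norm_apply_le w i
  rwa [hw, Real.norm_eq_abs] at this

lemma aux_norm_le {n : ℕ} (w : EuclideanSpace ℝ (Fin (n+1))) (M : ℝ) (h : ∀ i, |w i| ≤ M) :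
    ‖w‖ ≤ (n + 1) * M := by
  have hM : 0 ≤ M := (abs_nonneg _).trans (h 0)
  refine le_of_sq_le_sq ?_ (by positivity)
  rw [EuclideanSpace.real_norm_sq_eq]
  calc ∑ i, w i ^ 2 ≤ ∑ i : Fin (n+1), M ^ 2 := by
        refine Finset.sum_le_sum fun i _ => ?_
        rw [← sq_abs]; exact pow_le_pow_left₀ (abs_nonneg _) (h i) 2
    _ = (n + 1) * M ^ 2 := by simp
    _ ≤ ((n + 1) * M) ^ 2 := by
        have : (0:ℝ) ≤ n := n.cast_nonneg
        have := sq_nonneg M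
        nlinarith [mul_nonneg ‹(0:ℝ) ≤ n› this, mul_nonneg ‹(0:ℝ) ≤ n› (mul_nonneg ‹(0:ℝ) ≤ n› this)]

lemma aux_bilip {n : ℕ} (j : Fin (n+1)) {w v : EuclideanSpace ℝ (Fin (n+1))} (hw : ‖w‖ = 1)
    (hv : ‖v‖ = 1) (h : 1 / (n + 1 : ℝ) ≤ w j + v j) {δ : ℝ}
    (hδ : ∀ k, |w (j.succAbove k) - v (j.succAbove k)| ≤ δ) (hδ0 : 0 ≤ δ) :
    ‖w - v‖ ≤ 2 * (n + 1) ^ 3 * δ := by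
  have hn : (0:ℝ) ≤ n := n.cast_nonneg
  have hj : |w j - v j| ≤ 2 * (n + 1) ^ 2 * δ := by
    have e1 := aux_sq hw
    have e2 := aux_sq hv
    rw [Fin.sum_univ_succAbove _ j] at e1 e2
    have e3 : (w j - v j) * (w j + v j) =
        - ∑ k, (w (j.succAbove k) - v (j.succAbove k)) * (w (j.succAbove k) + v (j.succAbove k)) := by
      have : ∑ k, (w (j.succAbove k) - v (j.succAbove k)) * (w (j.succAbove k) + v (j.succAbove k))
        = ∑ k, w (j.succAbove k) ^ 2 - ∑ k, v (j.succAbove k) ^ 2 := by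
        rw [← Finset.sum_sub_distrib]; exact Finset.sum_congr rfl fun _ _ => by ring
      rw [this]; linear_combination e1 - e2
    have e4 : |w j - v j| * (w j + v j) ≤ n * (δ * 2) := by
      have hp : 0 ≤ w j + v j := le_trans (by positivity) h
      rw [← abs_of_nonneg hp, ← abs_mul, e3, abs_neg]
      refine (Finset.abs_sum_le_sum_abs _ _).trans ?_
      have : ∀ k ∈ Finset.univ, |(w (j.succAbove k) - v (j.succAbove k)) *
          (w (j.succAbove k) + v (j.succAbove k))| ≤ δ * 2 := by
        intro k _
        rw [abs_mul]
        refine mul_le_mul (hδ k) ?_ (abs_nonneg _) hδ0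
        refine (abs_add_le _ _).trans ?_
        linarith [aux_abs_le hw (j.succAbove k), aux_abs_le hv (j.succAbove k)]
      refine (Finset.sum_le_sum this).trans ?_
      simp
    have e5 : |w j - v j| * (1 / (n + 1 : ℝ)) ≤ n * (δ * 2) :=
      (mul_le_mul_of_nonneg_left h (abs_nonneg _)).trans e4
    rw [mul_one_div, div_le_iff₀ (by positivity)] at e5
    refine e5.trans ?_
    nlinarith [mul_nonneg hn hδ0]
  have := aux_norm_le (w - v) (2 * (n + 1) ^ 2 * δ) (by
    intro i
    rcases Fin.eq_self_or_eq_succAbove j i with rfl | ⟨k, rfl⟩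
    · simpa using hj
    · simp only [PiLp.sub_apply]
      refine (hδ k).trans ?_
      nlinarith [mul_nonneg hn hδ0, mul_nonneg hn (mul_nonneg hn hδ0)])
  linarith

lemma aux_dist_sq {n : ℕ} {w v : EuclideanSpace ℝ (Fin n)} (hw : ‖w‖ = 1) (hv : ‖v‖ = 1) :
    ‖w - v‖ ^ 2 = 2 - 2 * ∑ i, v i * w i := by
  rw [@norm_sub_sq_real, hw, hv]
  simp [PiLp.inner_apply]
  ring

lemma aux_sum_abs {n : ℕ} {w v : EuclideanSpace ℝ (Fin n)} (hw : ‖w‖ = 1) (hv : ‖v‖ = 1) :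
    Real.cos (Real.arccos (∑ i, v i * w i)) = ∑ i, v i * w i := by
  have := abs_real_inner_le_norm w v
  rw [hw, hv, abs_le] at this
  simp [PiLp.inner_apply] at this
  exact Real.cos_arccos this.1 this.2

lemma aux_norm_le_arccos {n : ℕ} {w v : EuclideanSpace ℝ (Fin n)} (hw : ‖w‖ = 1) (hv : ‖v‖ = 1) :
    ‖w - v‖ ≤ Real.arccos (∑ i, v i * w i) := by
  refine le_of_sq_le_sq ?_ (Real.arccos_nonneg _)
  rw [aux_dist_sq hw hv]
  have := Real.one_sub_sq_div_two_le_cos (x := Real.arccos (∑ i, v i * w i))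
  rw [aux_sum_abs hw hv] at this
  linarith

lemma aux_arccos_le {n : ℕ} {w v : EuclideanSpace ℝ (Fin n)} (hw : ‖w‖ = 1) (hv : ‖v‖ = 1) :
    Real.arccos (∑ i, v i * w i) ≤ 2 * ‖w - v‖ := by
  refine le_of_sq_le_sq ?_ (by positivity)
  rw [mul_pow, aux_dist_sq hw hv]
  have := Real.cos_le_one_sub_mul_cos_sq (x := Real.arccos (∑ i, v i * w i)) (by
    rw [abs_of_nonneg (Real.arccos_nonneg _)]; exact Real.arccos_le_pi _)
  rw [aux_sum_abs hw hv] at this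
  have h2 : (1:ℝ)/8 ≤ 2 / Real.pi ^ 2 := by
    rw [div_le_div_iff₀ (by norm_num) (by positivity)]
    nlinarith [Real.pi_le_four, Real.pi_pos]
  have h3 := mul_le_mul_of_nonneg_right h2 (sq_nonneg (Real.arccos (∑ i, v i * w i)))
  linarith

lemma aux_exists_max {n : ℕ} {w : EuclideanSpace ℝ (Fin (n+1))} (hw : ‖w‖ = 1) (hp : ∀ i, 0 < w i) :
    ∃ j, 1 / (n + 1 : ℝ) ≤ w j := by
  by_contra! h
  have := aux_sq hw
  have h2 : ∑ i, w i ^ 2 < ∑ i : Fin (n+1), 1 / (n + 1 : ℝ) := by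
    refine Finset.sum_lt_sum_of_nonempty Finset.univ_nonempty fun i _ => ?_
    have := aux_abs_le hw i
    rw [abs_of_pos (hp i)] at this
    nlinarith [h i, hp i]
  rw [this] at h2
  simp at h2
  field_simp at h2
  simp at h2

lemma auxP_meas {n : ℕ} (j : Fin (n+1)) : Measurable (auxP j) := (auxP_lip j).continuous.measurable

def auxCap {n : ℕ} (ξ : EuclideanSpace ℝ (Fin n)) (r : ℝ) : Set (EuclideanSpace ℝ (Fin n)) :=
  {w | ‖w‖ = 1 ∧ (∀ i, 0 < w i) ∧ Real.arccos (∑ i, ξ i * w i) < r}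

lemma auxCap_meas {n : ℕ} (ξ : EuclideanSpace ℝ (Fin n)) (r : ℝ) : MeasurableSet (auxCap ξ r) := by
  have h1 : MeasurableSet {w : EuclideanSpace ℝ (Fin n) | ‖w‖ = 1} :=
    measurableSet_eq_fun (by fun_prop) (by fun_prop)
  have h2 : MeasurableSet {w : EuclideanSpace ℝ (Fin n) | ∀ i, 0 < w i} := by
    rw [Set.ofPred_forall]
    exact MeasurableSet.iInter fun i => measurableSet_lt (by fun_prop) (by fun_prop)
  have h3 : MeasurableSet {w : EuclideanSpace ℝ (Fin n) | Real.arccos (∑ i, ξ i * w i) < r} :=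
    measurableSet_lt (Real.continuous_arccos.measurable.comp (by fun_prop)) (by fun_prop)
  exact h1.inter (h2.inter h3)

lemma aux_map_le {n : ℕ} (j : Fin (n+1)) (U : Set (EuclideanSpace ℝ (Fin (n+1))))
    (hU : ∀ w ∈ U, ‖w‖ = 1 ∧ 1 / (n + 1 : ℝ) ≤ w j) :
    Measure.map (auxP j) ((μH[(n:ℝ)]).restrict U) ≤
      ENNReal.ofReal ((2 * (n + 1) ^ 3) ^ n) • (volume : Measure (Fin n → ℝ)) := by
  refine Measure.le_iff.2 fun D hD => ?_
  rw [Measure.map_apply (auxP_meas j) hD, Measure.restrict_apply (auxP_meas j hD)]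
  set E := auxP j ⁻¹' D ∩ U with hE
  have hd : ∀ w ∈ E, ∀ v ∈ E, dist w v ≤ 2 * (n + 1 : ℝ) ^ 3 * dist (auxP j w) (auxP j v) := by
    intro w hw v hv
    rw [dist_eq_norm]
    have h1 := hU w hw.2
    have h2 := hU v hv.2
    have h0 : (0:ℝ) ≤ 1 / (n + 1 : ℝ) := by positivity
    refine aux_bilip j h1.1 h2.1 (by linarith) (fun k => ?_) dist_nonneg
    exact dist_le_pi_dist (auxP j w) (auxP j v) k
  have hinj : Set.InjOn (auxP j) E := by
    intro w hw v hv h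
    have := hd w hw v hv
    rw [h, dist_self, mul_zero] at this
    exact dist_le_zero.1 this
  have hinv : (Function.invFunOn (auxP j) E) '' (auxP j '' E) = E := by
    ext w; constructor
    · rintro ⟨_, ⟨v, hv, rfl⟩, rfl⟩
      exact Function.invFunOn_mem ⟨v, hv, rfl⟩
    · intro hw
      exact ⟨_, ⟨w, hw, rfl⟩, hinj.leftInvOn_invFunOn hw⟩
  have hL : LipschitzOnWith (2 * (n + 1) ^ 3) (Function.invFunOn (auxP j) E) (auxP j '' E) := by
    refine LipschitzOnWith.of_dist_le_mul ?_
    rintro _ ⟨w, hw, rfl⟩ _ ⟨v, hv, rfl⟩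
    rw [hinj.leftInvOn_invFunOn hw, hinj.leftInvOn_invFunOn hv]
    simpa using hd w hw v hv
  have := hL.hausdorffMeasure_image_le (d := n) n.cast_nonneg
  rw [hinv] at this
  refine this.trans ?_
  have hv := hausdorffMeasure_pi_real (ι := Fin n)
  rw [Fintype.card_fin] at hv
  rw [hv, Measure.smul_apply, smul_eq_mul, ENNReal.rpow_natCast]
  refine mul_le_mul' (le_of_eq ?_) (measure_mono ?_)
  · rw [ENNReal.ofReal_pow (by positivity)]
    congr 1
    rw [← ENNReal.ofReal_coe_nnreal]
    simp
  · rintro _ ⟨w, hw, rfl⟩; exact hw.1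

lemma aux_upper_j {n : ℕ} (γ : Fin (n+1) → ℝ) (hγ : ∀ i, -1 < γ i) (j : Fin (n+1)) :
    ∃ C : ℝ, 0 < C ∧ ∀ ξ : EuclideanSpace ℝ (Fin (n+1)), ‖ξ‖ = 1 → (∀ i, 0 < ξ i) →
        ∀ r : ℝ, 0 < r → r ≤ 2 * Real.pi →
      (∫⁻ w in auxCap ξ r ∩ {w | 1 / (n + 1 : ℝ) ≤ w j},
            ENNReal.ofReal (∏ i, (w i) ^ γ i) ∂(μH[(n : ℝ)])) ≤
            ENNReal.ofReal (C * r ^ n * ∏ i, (ξ i + r) ^ γ i) := by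
  choose C hC h1d using fun i => aux_1d (hγ i)
  refine ⟨(8 * (n + 1)) ^ |γ j| * (2 * (n + 1) ^ 3) ^ n * ∏ k, C (j.succAbove k),
    mul_pos (by positivity) (Finset.prod_pos fun k _ => hC _), fun ξ hξ hξp r hr hr2 => ?_⟩
  set U := auxCap ξ r ∩ {w | 1 / (n + 1 : ℝ) ≤ w j} with hUdef
  have hUm : MeasurableSet U :=
    (auxCap_meas ξ r).inter (measurableSet_le (by fun_prop) (by fun_prop))
  have hclose : ∀ w ∈ U, ∀ i, |w i - ξ i| < r := by
    intro w hw i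
    have := PiLp.norm_apply_le (w - ξ) i
    rw [PiLp.sub_apply, Real.norm_eq_abs] at this
    exact lt_of_le_of_lt (this.trans (aux_norm_le_arccos hw.1.1 hξ)) hw.1.2.2
  set h : Fin n → ℝ → ENNReal := fun k =>
    (Set.Ioo (max 0 (ξ (j.succAbove k) - r)) (ξ (j.succAbove k) + r)).indicator
      (fun t => ENNReal.ofReal (t ^ γ (j.succAbove k))) with hh
  have hhm : ∀ k, Measurable (h k) := fun k =>
    Measurable.indicator (by fun_prop) measurableSet_Ioo
  have hFm : Measurable (fun x : Fin n → ℝ => ∏ k, h k (x k)) :=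
    Finset.measurable_prod _ fun k _ => (hhm k).comp (measurable_pi_apply k)
  have hn : (0:ℝ) ≤ n := n.cast_nonneg
  have hsp : ∀ i, 0 < ξ i + r := fun i => by linarith [hξp i]
  calc ∫⁻ w in U, ENNReal.ofReal (∏ i, (w i) ^ γ i) ∂(μH[(n : ℝ)])
      ≤ ∫⁻ w in U, ENNReal.ofReal ((8 * (n + 1)) ^ |γ j| * (ξ j + r) ^ γ j) *
          ∏ k, h k (auxP j w k) ∂(μH[(n : ℝ)]) := by
        refine setLIntegral_mono' hUm fun w hw => ?_
        have hwp := hw.1.2.1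
        rw [Fin.prod_univ_succAbove _ j, ENNReal.ofReal_mul (Real.rpow_nonneg (hwp j).le _),
          ENNReal.ofReal_prod_of_nonneg (fun k _ => Real.rpow_nonneg (hwp _).le _)]
        refine mul_le_mul' (ENNReal.ofReal_le_ofReal ?_) (le_of_eq (Finset.prod_congr rfl ?_))
        · have h2 : 1 / (n + 1 : ℝ) ≤ w j := hw.2
          rw [div_le_iff₀ (by positivity)] at h2
          have h3 := abs_lt.1 (hclose w hw j)
          have h4 := abs_le.1 (aux_abs_le hξ j)
          refine aux_rpow_le (hwp j) (hsp j) (by linarith) ?_ ?_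
          · nlinarith [hsp j, mul_nonneg hn (hsp j).le]
          · nlinarith [Real.pi_lt_d2]
        · intro k _
          have h3 := abs_lt.1 (hclose w hw (j.succAbove k))
          rw [hh]
          simp only [auxP]
          rw [Set.indicator_of_mem]
          exact ⟨max_lt (hwp _) (by linarith), by linarith⟩
    _ = ENNReal.ofReal ((8 * (n + 1)) ^ |γ j| * (ξ j + r) ^ γ j) *
          ∫⁻ x, ∏ k, h k (x k) ∂(Measure.map (auxP j) ((μH[(n:ℝ)]).restrict U)) := by
        rw [lintegral_map hFm (auxP_meas j)]
        exact lintegral_const_mul _ (hFm.comp (auxP_meas j))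
    _ ≤ ENNReal.ofReal ((8 * (n + 1)) ^ |γ j| * (ξ j + r) ^ γ j) *
          ∫⁻ x, ∏ k, h k (x k) ∂(ENNReal.ofReal ((2 * (n + 1) ^ 3) ^ n) •
            (volume : Measure (Fin n → ℝ))) := by
        gcongr
        exact aux_map_le j U fun w hw => ⟨hw.1.1, hw.2⟩
    _ = ENNReal.ofReal ((8 * (n + 1)) ^ |γ j| * (ξ j + r) ^ γ j) *
          (ENNReal.ofReal ((2 * (n + 1) ^ 3) ^ n) * ∏ k, ∫⁻ t, h k t) := by
        rw [lintegral_smul_measure, aux_lintegral_prod _ _ hhm, smul_eq_mul]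
    _ ≤ ENNReal.ofReal ((8 * (n + 1)) ^ |γ j| * (ξ j + r) ^ γ j) *
          (ENNReal.ofReal ((2 * (n + 1) ^ 3) ^ n) * ∏ k : Fin n, ENNReal.ofReal
            (C (j.succAbove k) * (r * (ξ (j.succAbove k) + r) ^ γ (j.succAbove k)))) := by
        gcongr with k
        exact h1d _ _ _ (hξp _) hr
    _ = _ := by
        have hj := Real.rpow_pos_of_pos (hsp j) (γ j)
        rw [← ENNReal.ofReal_prod_of_nonneg, ← ENNReal.ofReal_mul (by positivity),
          ← ENNReal.ofReal_mul (by positivity)]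
        · congr 1
          rw [Fin.prod_univ_succAbove (fun i => (ξ i + r) ^ γ i) j, Finset.prod_mul_distrib,
            Finset.prod_mul_distrib]
          simp
          ring
        · intro k _
          have := hC (j.succAbove k)
          have := Real.rpow_pos_of_pos (hsp (j.succAbove k)) (γ (j.succAbove k))
          positivity

lemma aux_upper {n : ℕ} (γ : Fin (n+1) → ℝ) (hγ : ∀ i, -1 < γ i) :
    ∃ C : ℝ, 0 < C ∧ ∀ ξ : EuclideanSpace ℝ (Fin (n+1)), ‖ξ‖ = 1 → (∀ i, 0 < ξ i) →
        ∀ r : ℝ, 0 < r → r ≤ 2 * Real.pi →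
      (∫⁻ w in auxCap ξ r, ENNReal.ofReal (∏ i, (w i) ^ γ i) ∂(μH[(n : ℝ)])) ≤
            ENNReal.ofReal (C * r ^ n * ∏ i, (ξ i + r) ^ γ i) := by
  choose C hC h using aux_upper_j γ hγ
  refine ⟨∑ j, C j, Finset.sum_pos (fun j _ => hC j) Finset.univ_nonempty,
    fun ξ hξ hξp r hr hr2 => ?_⟩
  have hsub : auxCap ξ r ⊆ ⋃ j : Fin (n+1), auxCap ξ r ∩ {w | 1 / (n + 1 : ℝ) ≤ w j} := by
    intro w hw
    obtain ⟨j, hj⟩ := aux_exists_max hw.1 hw.2.1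
    exact Set.mem_iUnion.2 ⟨j, hw, hj⟩
  refine (lintegral_mono_set hsub).trans ((lintegral_iUnion_le _ _).trans ?_)
  rw [tsum_fintype]
  have hP : 0 ≤ ∏ i, (ξ i + r) ^ γ i :=
    Finset.prod_nonneg fun i _ => Real.rpow_nonneg (by linarith [hξp i]) _
  rw [Finset.sum_mul, Finset.sum_mul, ENNReal.ofReal_sum_of_nonneg]
  · exact Finset.sum_le_sum fun j _ => h j ξ hξ hξp r hr hr2
  · intro j _
    have := hC j
    positivity

lemma aux_lower {n : ℕ} (γ : Fin (n+1) → ℝ) :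
    ∃ C : ℝ, 0 < C ∧ ∀ ξ : EuclideanSpace ℝ (Fin (n+1)), ‖ξ‖ = 1 → (∀ i, 0 < ξ i) →
        ∀ r : ℝ, 0 < r → r ≤ 2 * Real.pi →
      ENNReal.ofReal (C * r ^ n * ∏ i, (ξ i + r) ^ γ i) ≤
      (∫⁻ w in auxCap ξ r, ENNReal.ofReal (∏ i, (w i) ^ γ i) ∂(μH[(n : ℝ)])) := by
  obtain ⟨N, hN⟩ : ∃ N : ℝ, N = n + 1 := ⟨_, rfl⟩
  have hn : (0:ℝ) ≤ n := n.cast_nonneg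
  have hN1 : 1 ≤ N := by linarith
  obtain ⟨ε, hε⟩ : ∃ ε : ℝ, ε = 1 / (28 * N ^ 4) := ⟨_, rfl⟩
  have hε0 : 0 < ε := by rw [hε]; positivity
  have hεN : ε * (28 * N ^ 4) = 1 := by rw [hε]; field_simp
  have hε1 : ε ≤ 1 := by
    rw [hε, div_le_one (by positivity)]
    have := one_le_pow₀ hN1 (n := 4)
    linarith
  obtain ⟨K, hK⟩ : ∃ K : ℝ, K = 56 * N ^ 4 := ⟨_, rfl⟩
  have hN4 : N ≤ N ^ 4 := le_self_pow₀ hN1 (by norm_num)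
  have hKε : K * (ε / 2) = 1 := by rw [hK]; linarith
  have hK1 : 1 ≤ K := by linarith
  have hK16 : 16 * N ≤ K := by linarith
  have hK0 : 0 < K := by linarith
  refine ⟨(∏ i, (K ^ |γ i|)⁻¹) * (ε / 2) ^ n, mul_pos (Finset.prod_pos fun i _ => by positivity)
    (by positivity), fun ξ hξ hξp r hr hr2 => ?_⟩
  obtain ⟨j, hj⟩ := aux_exists_max hξ hξp
  rw [← hN] at hj
  have hr7 : r ≤ 7 := by linarith [Real.pi_lt_d2]
  have hsp : ∀ i, 0 < ξ i + r := fun i => by linarith [hξp i]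
  set A : Set (Fin n → ℝ) := Set.univ.pi fun k =>
    Set.Ioo (ξ (j.succAbove k) + ε / 2 * r) (ξ (j.succAbove k) + ε * r) with hA
  set B : Set (EuclideanSpace ℝ (Fin (n+1))) := {w | ‖w‖ = 1} ∩ {w | 0 < w j} ∩ auxP j ⁻¹' A with hB
  have hBm : MeasurableSet B := by
    refine ((measurableSet_eq_fun (by fun_prop) (by fun_prop)).inter
      (measurableSet_lt (by fun_prop) (by fun_prop))).inter (auxP_meas j ?_)
    exact MeasurableSet.univ_pi fun k => measurableSet_Ioo
  have hBk : ∀ w ∈ B, ∀ k, ξ (j.succAbove k) + ε / 2 * r < w (j.succAbove k) ∧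
      w (j.succAbove k) < ξ (j.succAbove k) + ε * r := fun w hw k => hw.2 k trivial
  have her : 0 < ε * r := by positivity
  have hBd : ∀ w ∈ B, ‖w - ξ‖ ≤ 2 * N ^ 3 * (ε * r) := by
    intro w hw
    have hw0 : 0 < w j := hw.1.2
    rw [hN]
    refine aux_bilip j hw.1.1 hξ (by rw [← hN]; linarith) (fun k => ?_) her.le
    have := hBk w hw k
    rw [abs_le]
    constructor <;> nlinarith
  have hBj : ∀ w ∈ B, 1 / (2 * N) ≤ w j := by
    intro w hw
    have h1 := PiLp.norm_apply_le (w - ξ) j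
    rw [PiLp.sub_apply, Real.norm_eq_abs] at h1
    have h2 := abs_le.1 (h1.trans (hBd w hw))
    have h3 : 2 * N ^ 3 * (ε * r) ≤ 1 / (2 * N) := by
      rw [le_div_iff₀ (by positivity)]
      calc 2 * N ^ 3 * (ε * r) * (2 * N) = (ε * (28 * N ^ 4)) * (r / 7) := by ring
        _ ≤ 1 := by rw [hεN]; linarith
    have h4 : 1 / N = 1 / (2 * N) + 1 / (2 * N) := by field_simp; norm_num
    linarith
  have hBp : ∀ w ∈ B, ∀ i, 0 < w i := by
    intro w hw i
    rcases Fin.eq_self_or_eq_succAbove j i with rfl | ⟨k, rfl⟩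
    · exact hw.1.2
    · have := (hBk w hw k).1
      have := hξp (j.succAbove k)
      have : 0 < ε / 2 * r := by positivity
      linarith
  have hBsub : B ⊆ auxCap ξ r := by
    intro w hw
    refine ⟨hw.1.1, hBp w hw, ?_⟩
    refine (aux_arccos_le hw.1.1 hξ).trans_lt ?_
    have h1 := hBd w hw
    have h5 : N ^ 3 ≤ N ^ 4 := pow_le_pow_right₀ hN1 (by norm_num)
    have h6 : ε * N ^ 3 ≤ ε * N ^ 4 := by gcongr
    have h7 : (ε * N ^ 3) * r ≤ 1 / 28 * r := by gcongr; linarith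
    nlinarith
  have hBval : ∀ w ∈ B, (∏ i, (K ^ |γ i|)⁻¹) * ∏ i, (ξ i + r) ^ γ i ≤ ∏ i, w i ^ γ i := by
    intro w hw
    rw [← Finset.prod_mul_distrib]
    refine Finset.prod_le_prod (fun i _ => ?_) fun i _ => ?_
    · have := Real.rpow_pos_of_pos (hsp i) (γ i)
      positivity
    · rw [inv_mul_le_iff₀ (by positivity)]
      have hwi := hBp w hw i
      rcases Fin.eq_self_or_eq_succAbove j i with rfl | ⟨k, rfl⟩
      · have h1 := hBj w hw
        rw [div_le_iff₀ (by positivity)] at h1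
        have h2 := (abs_le.1 (aux_abs_le hw.1.1 i)).2
        have h3 := (abs_le.1 (aux_abs_le hξ i)).2
        rw [div_le_iff₀ (by positivity)] at hj
        refine aux_rpow_le (hsp i) hwi hK1 ?_ ?_
        · nlinarith
        · nlinarith [hξp i]
      · have h1 := hBk w hw k
        have h2 := hξp (j.succAbove k)
        refine aux_rpow_le (hsp _) hwi hK1 ?_ ?_
        · calc ξ (j.succAbove k) + r = K * (ε / 2) * (ξ (j.succAbove k) + r) := by rw [hKε, one_mul]
            _ ≤ K * w (j.succAbove k) := by
              rw [mul_assoc]; gcongr; nlinarith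
        · nlinarith [hsp (j.succAbove k)]
  have hAsub : A ⊆ auxP j '' B := by
    intro x hx
    have hxk : ∀ k, ξ (j.succAbove k) + ε / 2 * r < x k ∧ x k < ξ (j.succAbove k) + ε * r :=
      fun k => hx k trivial
    have hsum : ∑ k, x k ^ 2 < 1 := by
      have e1 := aux_sq hξ
      rw [Fin.sum_univ_succAbove _ j] at e1
      have e2 : ∑ k, x k ^ 2 ≤ ∑ k, (ξ (j.succAbove k) ^ 2 + 3 * (ε * r)) := by
        refine Finset.sum_le_sum fun k _ => ?_
        have h1 := hxk k
        have h2 := hξp (j.succAbove k)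
        have h3 := (abs_le.1 (aux_abs_le hξ (j.succAbove k))).2
        have h4 : 0 < ε / 2 * r := by positivity
        have h5 : ε * r ≤ 1 := by
          have : ε * 28 ≤ 1 := by
            rw [← hεN]; gcongr; linarith
          nlinarith
        nlinarith
      rw [Finset.sum_add_distrib] at e2
      simp only [Finset.sum_const, Finset.card_univ, Fintype.card_fin, nsmul_eq_mul] at e2
      have e3 : (1 / N) ^ 2 ≤ ξ j ^ 2 := by gcongr
      have e4 : n * (3 * (ε * r)) < (1 / N) ^ 2 := by
        rw [div_pow, one_pow, lt_div_iff₀ (by positivity)]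
        calc n * (3 * (ε * r)) * N ^ 2 ≤ N * (3 * (ε * 7)) * N ^ 2 := by
              gcongr; linarith
          _ = 21 * (ε * N ^ 3) := by ring
          _ ≤ 21 * (ε * N ^ 4) := by gcongr; norm_num
          _ < 1 := by linarith
      linarith
    have hx0 : 0 < 1 - ∑ k, x k ^ 2 := by linarith
    refine ⟨WithLp.toLp 2 (j.insertNth (Real.sqrt (1 - ∑ k, x k ^ 2)) x), ⟨⟨?_, ?_⟩, ?_⟩, ?_⟩
    · rw [Set.mem_ofPred_eq, ← sq_eq_sq₀ (norm_nonneg _) zero_le_one, EuclideanSpace.real_norm_sq_eq,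
        Fin.sum_univ_succAbove _ j]
      simp [Real.sq_sqrt hx0.le]
    · simpa using hx0
    · rw [Set.mem_preimage]
      convert hx using 1
      ext k; simp [auxP]
    · ext k; simp [auxP]
  have hvol : ENNReal.ofReal ((ε / 2 * r) ^ n) ≤ μH[(n:ℝ)] B := by
    have h1 := (auxP_lip j).hausdorffMeasure_image_le (d := n) hn B
    have hv := hausdorffMeasure_pi_real (ι := Fin n)
    rw [Fintype.card_fin] at hv
    rw [hv] at h1
    simp only [ENNReal.coe_one, ENNReal.one_rpow, one_mul] at h1
    refine le_trans (le_of_eq ?_) ((measure_mono hAsub).trans h1)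
    rw [hA, Real.volume_pi_Ioo]
    have : ∀ k : Fin n, ξ (j.succAbove k) + ε * r - (ξ (j.succAbove k) + ε / 2 * r) = ε / 2 * r := by
      intro k; ring
    simp only [this, Finset.prod_const, Finset.card_univ, Fintype.card_fin]
    rw [ENNReal.ofReal_pow (by positivity)]
  have hP : 0 ≤ ∏ i, (ξ i + r) ^ γ i :=
    Finset.prod_nonneg fun i _ => Real.rpow_nonneg (hsp i).le _
  have hP2 : 0 ≤ ∏ i, (K ^ |γ i|)⁻¹ :=
    Finset.prod_nonneg fun i _ => by positivity
  calc ENNReal.ofReal ((∏ i, (K ^ |γ i|)⁻¹) * (ε / 2) ^ n * r ^ n * ∏ i, (ξ i + r) ^ γ i)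
      = ENNReal.ofReal ((∏ i, (K ^ |γ i|)⁻¹) * ∏ i, (ξ i + r) ^ γ i) *
          ENNReal.ofReal ((ε / 2 * r) ^ n) := by
        rw [← ENNReal.ofReal_mul (by positivity), mul_pow]
        congr 1; ring
    _ ≤ ENNReal.ofReal ((∏ i, (K ^ |γ i|)⁻¹) * ∏ i, (ξ i + r) ^ γ i) * μH[(n:ℝ)] B := by gcongr
    _ = ∫⁻ w in B, ENNReal.ofReal ((∏ i, (K ^ |γ i|)⁻¹) * ∏ i, (ξ i + r) ^ γ i) ∂(μH[(n:ℝ)]) := by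
        rw [setLIntegral_const]
    _ ≤ ∫⁻ w in B, ENNReal.ofReal (∏ i, (w i) ^ γ i) ∂(μH[(n : ℝ)]) :=
        setLIntegral_mono' hBm fun w hw => ENNReal.ofReal_le_ofReal (hBval w hw)
    _ ≤ _ := lintegral_mono_set hBsub


/-- For fixed `d ≥ 2` and `γ ∈ (−1,∞)^d` there exist `0 < c₁ ≤ c₂` such that
for every `ξ ∈ S^{d−1}_+` and every `0 < r ≤ 2π`,
`c₁ r^{d−1} ∏ (ξ_i + r)^{γ_i} ≤ ∫_{c⁺(ξ,r)} w^γ dσ(w) ≤ c₂ r^{d−1} ∏ (ξ_i + r)^{γ_i}`,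
where `σ` is the natural `(d−1)`-dimensional surface (Hausdorff) measure on the unit sphere,
`c⁺(ξ,r) = {w ∈ S^{d−1}_+ : arccos⟨ξ,w⟩ < r}` and `w^γ = ∏ w_i^{γ_i}`. -/
theorem stmt3 (d : ℕ) (hd : 2 ≤ d) (γ : Fin d → ℝ) (hγ : ∀ i, -1 < γ i) :
    ∃ c₁ c₂ : ℝ, 0 < c₁ ∧ c₁ ≤ c₂ ∧
      ∀ ξ : EuclideanSpace ℝ (Fin d), ‖ξ‖ = 1 → (∀ i, 0 < ξ i) →
        ∀ r : ℝ, 0 < r → r ≤ 2 * Real.pi →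
          ENNReal.ofReal (c₁ * r ^ (d - 1) * ∏ i, (ξ i + r) ^ γ i) ≤
            (∫⁻ w in {w : EuclideanSpace ℝ (Fin d) |
                ‖w‖ = 1 ∧ (∀ i, 0 < w i) ∧ Real.arccos (∑ i, ξ i * w i) < r},
              ENNReal.ofReal (∏ i, (w i) ^ γ i) ∂(μH[(d - 1 : ℝ)])) ∧
          (∫⁻ w in {w : EuclideanSpace ℝ (Fin d) |
              ‖w‖ = 1 ∧ (∀ i, 0 < w i) ∧ Real.arccos (∑ i, ξ i * w i) < r},
            ENNReal.ofReal (∏ i, (w i) ^ γ i) ∂(μH[(d - 1 : ℝ)])) ≤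
            ENNReal.ofReal (c₂ * r ^ (d - 1) * ∏ i, (ξ i + r) ^ γ i) := by
  obtain ⟨n, rfl⟩ : ∃ n, d = n + 1 := ⟨d - 1, by omega⟩
  obtain ⟨c, hc, hl⟩ := aux_lower γ
  obtain ⟨C, hC, hu⟩ := aux_upper γ hγ
  refine ⟨c, max c C, hc, le_max_left _ _, fun ξ hξ hξp r hr hr2 => ?_⟩
  have e : ((n + 1 : ℕ) : ℝ) - 1 = n := by push_cast; ring
  rw [e, Nat.add_sub_cancel]
  refine ⟨hl ξ hξ hξp r hr hr2, (hu ξ hξ hξp r hr hr2).trans (ENNReal.ofReal_le_ofReal ?_)⟩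
  have hP : 0 ≤ ∏ i, (ξ i + r) ^ γ i :=
    Finset.prod_nonneg fun i _ => Real.rpow_nonneg (by linarith [hξp i]) _
  gcongr
  exact le_max_right _ _
end

section
/- Let d ≥ 2 and γ ∈ (−1,∞)^d be fixed. Then there exist constants 0 < c₁ ≤ c₂ (depending only on d and γ) such that for every ξ ∈ S^{d−1}_+ and every 0 < r ≤ 2π, c₁ r^{d−1} ≤ ∫_{c⁺(ξ,r)} (∏_{i=1}^d (w_i + r)^{−γ_i}) w^γ dσ(w) ≤ c₂ r^{d−1}. -/
open MeasureTheory

lemma one_d (γ : ℝ) (hγ : -1 < γ) : ∃ C : ℝ, 0 < C ∧ ∀ a r : ℝ, 0 < r →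
    ∫⁻ t in Set.Ioi 0 ∩ Set.Icc (a - r) (a + r), ENNReal.ofReal ((t + r) ^ (-γ) * t ^ γ)
      ≤ ENNReal.ofReal (C * r) := by
  have h2 : (0:ℝ) < 2 ^ (-γ) / (γ + 1) := by
    have : 0 < γ + 1 := by linarith
    positivity
  refine ⟨4 + 2 ^ (-γ) / (γ + 1), by linarith, ?_⟩
  intro a r hr
  have hms : MeasurableSet (Set.Ioi (0:ℝ) ∩ Set.Icc (a - r) (a + r)) := by measurability
  have key : ∀ t ∈ Set.Ioi (0:ℝ) ∩ Set.Icc (a - r) (a + r),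
      ENNReal.ofReal ((t + r) ^ (-γ) * t ^ γ) ≤
        2 + (Set.Ioc 0 r).indicator (fun t => ENNReal.ofReal ((2*r)^(-γ) * t ^ γ)) t := by
    rintro t ⟨ht, -⟩
    have ht : 0 < t := ht
    have e2 : (2:ENNReal) = ENNReal.ofReal 2 := by simp
    by_cases htr : t ≤ r ∧ γ < 0
    · rw [Set.indicator_of_mem (show t ∈ Set.Ioc 0 r from ⟨ht, htr.1⟩)]
      refine le_trans (ENNReal.ofReal_le_ofReal ?_) le_add_self
      have : (t + r) ^ (-γ) ≤ (2*r)^(-γ) :=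
        Real.rpow_le_rpow (by positivity) (by linarith) (by linarith)
      gcongr
    · refine le_trans ?_ le_self_add
      rw [e2]
      apply ENNReal.ofReal_le_ofReal
      by_cases hg : γ < 0
      · have htr : r < t := by
          by_contra h; exact htr ⟨by linarith, hg⟩
        have h1 : (t + r) ^ (-γ) ≤ (2*t)^(-γ) :=
          Real.rpow_le_rpow (by positivity) (by linarith) (by linarith)
        have h3 : (2:ℝ)^(-γ) ≤ 2^(1:ℝ) := Real.rpow_le_rpow_of_exponent_le (by norm_num) (by linarith)
        have h4 : t ^ (-γ) * t ^ γ = 1 := by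
          rw [← Real.rpow_add ht]; simp
        calc (t + r) ^ (-γ) * t ^ γ ≤ (2*t)^(-γ) * t ^ γ := by gcongr
          _ = 2^(-γ) * (t ^ (-γ) * t ^ γ) := by
            rw [Real.mul_rpow (by norm_num) ht.le]; ring
          _ ≤ 2 := by rw [h4]; simpa using h3
      · have h1 : t ^ γ ≤ (t + r) ^ γ :=
          Real.rpow_le_rpow (by positivity) (by linarith) (by linarith)
        have h4 : (t+r) ^ (-γ) * (t+r) ^ γ = 1 := by
          rw [← Real.rpow_add (by linarith)]; simp
        calc (t + r) ^ (-γ) * t ^ γ ≤ (t + r) ^ (-γ) * (t+r) ^ γ := by gcongr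
          _ ≤ 2 := by rw [h4]; norm_num
  have hi : ∫⁻ t in Set.Ioc 0 r, ENNReal.ofReal ((2*r)^(-γ) * t ^ γ) =
      ENNReal.ofReal (2 ^ (-γ) / (γ + 1) * r) := by
    rw [← ofReal_integral_eq_lintegral_ofReal]
    · congr 1
      rw [← intervalIntegral.integral_of_le hr.le, intervalIntegral.integral_const_mul,
        integral_rpow (Or.inl hγ), Real.zero_rpow (by linarith), Real.mul_rpow (by norm_num) hr.le,
        Real.rpow_add hr, Real.rpow_one, Real.rpow_neg hr.le]
      have : r ^ γ ≠ 0 := (Real.rpow_pos_of_pos hr _).ne'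
      field_simp
      ring
    · have := (intervalIntegral.intervalIntegrable_rpow' (a := 0) (b := r) hγ).const_mul ((2*r)^(-γ))
      exact (intervalIntegrable_iff_integrableOn_Ioc_of_le hr.le).1 this
    · refine (ae_restrict_mem measurableSet_Ioc).mono fun t ht => ?_
      have := ht.1
      simp only [Pi.zero_apply]
      positivity
  calc _ ≤ ∫⁻ t in Set.Ioi 0 ∩ Set.Icc (a - r) (a + r), (2 + (Set.Ioc 0 r).indicator (fun t => ENNReal.ofReal ((2*r)^(-γ) * t ^ γ)) t) :=
        setLIntegral_mono' hms key
    _ = 2 * volume (Set.Ioi 0 ∩ Set.Icc (a - r) (a + r)) + ∫⁻ t in Set.Ioi 0 ∩ Set.Icc (a - r) (a + r), (Set.Ioc 0 r).indicator (fun t => ENNReal.ofReal ((2*r)^(-γ) * t ^ γ)) t := by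
        rw [lintegral_add_left measurable_const]; simp
    _ ≤ 2 * volume (Set.Icc (a - r) (a + r)) + ∫⁻ t, (Set.Ioc 0 r).indicator (fun t => ENNReal.ofReal ((2*r)^(-γ) * t ^ γ)) t := by
        gcongr
        · exact Set.inter_subset_right
        · exact Measure.restrict_le_self
    _ = ENNReal.ofReal ((4 + 2 ^ (-γ) / (γ + 1)) * r) := by
        rw [lintegral_indicator measurableSet_Ioc, hi, Real.volume_Icc,
          show (2:ENNReal) = ENNReal.ofReal 2 by simp, ← ENNReal.ofReal_mul (by norm_num),
          ← ENNReal.ofReal_add (by nlinarith) (by positivity)]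
        congr 1; ring


lemma lint_prod : ∀ (n : ℕ) (μ : Fin n → Measure ℝ) [∀ i, SigmaFinite (μ i)]
    (f : Fin n → ℝ → ENNReal) (_ : ∀ i, Measurable (f i)),
    ∫⁻ y, ∏ i, f i (y i) ∂(Measure.pi μ) = ∏ i, ∫⁻ t, f i t ∂(μ i)
  | 0, μ, _, f, hf => by simp
  | n + 1, μ, _, f, hf => by
    have hm := (measurePreserving_piFinSuccAbove μ 0).symm
    rw [← hm.lintegral_comp_emb (MeasurableEquiv.measurableEmbedding _)]
    simp_rw [MeasurableEquiv.piFinSuccAbove_symm_apply, Fin.insertNthEquiv,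
      Fin.prod_univ_succ, Fin.insertNth_zero, Equiv.coe_fn_mk, Fin.cons_succ,
      Fin.zero_succAbove, Fin.cons_zero]
    have h := lint_prod n (fun i => μ i.succ) (fun i => f i.succ) (fun i => hf _)
    rw [← h]
    exact lintegral_prod_mul (hf 0).aemeasurable
      (Finset.measurable_prod _ fun i _ => (hf _).comp (measurable_pi_apply i)).aemeasurable

lemma haus_le {X Y : Type*} [MetricSpace X] [MeasurableSpace X] [BorelSpace X]
    [MetricSpace Y] [MeasurableSpace Y] [BorelSpace Y] (P : X → Y) (T : Set X) (K : NNReal)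
    (h : ∀ x ∈ T, ∀ y ∈ T, dist x y ≤ K * dist (P x) (P y)) (s : ℝ) (hs : 0 ≤ s) :
    μH[s] T ≤ (K : ENNReal) ^ s * μH[s] (P '' T) := by
  have ha : AntilipschitzWith K (fun x : T => P x) :=
    AntilipschitzWith.of_le_mul_dist fun x y => h x x.2 y y.2
  have := ha.le_hausdorffMeasure_image hs Set.univ
  rw [← isometry_subtype_coe.hausdorffMeasure_image (Or.inl hs)] at this
  convert this using 3
  · simp
  · ext; simp

lemma lint_le {X Y : Type*} [MetricSpace X] [MeasurableSpace X] [BorelSpace X]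
    [MetricSpace Y] [MeasurableSpace Y] [BorelSpace Y] (P : X → Y) (hP : Measurable P)
    (T : Set X) (Q : Set Y) (hTQ : Set.MapsTo P T Q) (K : NNReal)
    (h : ∀ x ∈ T, ∀ y ∈ T, dist x y ≤ K * dist (P x) (P y)) (s : ℝ) (hs : 0 ≤ s)
    (g : Y → ENNReal) (hg : Measurable g) :
    ∫⁻ x in T, g (P x) ∂μH[s] ≤ (K : ENNReal) ^ s * ∫⁻ y in Q, g y ∂μH[s] := by
  have hle : Measure.map P (Measure.restrict μH[s] T) ≤ (K : ENNReal) ^ s • (Measure.restrict μH[s] Q) := by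
    rw [Measure.le_iff]
    intro B hB
    rw [Measure.map_apply hP hB, Measure.restrict_apply (hP hB), Measure.smul_apply,
      Measure.restrict_apply hB, smul_eq_mul]
    refine (haus_le P (P ⁻¹' B ∩ T) K (fun x hx y hy => h x hx.2 y hy.2) s hs).trans ?_
    gcongr
    rintro _ ⟨x, hx, rfl⟩
    exact ⟨hx.1, hTQ hx.2⟩
  rw [← lintegral_map hg hP, ← smul_eq_mul, ← lintegral_smul_measure]
  exact lintegral_mono' hle le_rfl

lemma fac (γ t r m : ℝ) (ht : 0 < t) (hr : 0 < r) (hm : 0 < m) (h : m * (t + r) ≤ t) :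
    m ^ |γ| ≤ (t + r) ^ (-γ) * t ^ γ ∧ (t + r) ^ (-γ) * t ^ γ ≤ m⁻¹ ^ |γ| := by
  have htr : 0 < t + r := by linarith
  have hm1 : m ≤ 1 := by
    by_contra hh
    nlinarith
  have e : (t + r) ^ (-γ) * t ^ γ = (t / (t + r)) ^ γ := by
    rw [Real.div_rpow ht.le htr.le, Real.rpow_neg htr.le]; ring
  rw [e]
  have h1 : m ≤ t / (t + r) := by rw [le_div_iff₀ htr]; exact h
  have h2 : t / (t + r) ≤ 1 := by rw [div_le_one htr]; linarith
  have h0 : 0 < t / (t + r) := by positivity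
  have hmi : 1 ≤ m⁻¹ := (one_le_inv₀ hm).2 hm1
  rcases le_or_gt 0 γ with hg | hg
  · rw [abs_of_nonneg hg]
    refine ⟨Real.rpow_le_rpow hm.le h1 hg, ?_⟩
    exact (Real.rpow_le_one h0.le h2 hg).trans (Real.one_le_rpow hmi hg)
  · rw [abs_of_neg hg]
    have e3 : (t / (t + r)) ^ γ = ((t / (t + r))⁻¹) ^ (-γ) := by
      rw [Real.inv_rpow h0.le, Real.rpow_neg h0.le, inv_inv]
    rw [e3]
    refine ⟨(Real.rpow_le_one hm.le hm1 (by linarith)).trans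
      (Real.one_le_rpow ((one_le_inv₀ h0).2 h2) (by linarith)), ?_⟩
    exact Real.rpow_le_rpow (by positivity) (inv_anti₀ hm h1) (by linarith)

lemma sumsq {d : ℕ} {w : EuclideanSpace ℝ (Fin d)} (h : ‖w‖ = 1) : ∑ i, w i ^ 2 = 1 := by
  rw [← EuclideanSpace.real_norm_sq_eq, h]; norm_num

lemma ip {d : ℕ} {ξ w : EuclideanSpace ℝ (Fin d)} (hξ : ‖ξ‖ = 1) (hw : ‖w‖ = 1) :
    ∑ i, (w i - ξ i) ^ 2 = 2 - 2 * ∑ i, ξ i * w i := by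
  have h1 := sumsq hξ
  have h2 := sumsq hw
  have : ∑ i, (w i - ξ i) ^ 2 = ∑ i, w i ^ 2 + ∑ i, ξ i ^ 2 - 2 * ∑ i, ξ i * w i := by
    rw [Finset.mul_sum, ← Finset.sum_add_distrib, ← Finset.sum_sub_distrib]
    exact Finset.sum_congr rfl fun i _ => by ring
  rw [this, h1, h2]; ring

lemma coord_close {d : ℕ} {ξ w : EuclideanSpace ℝ (Fin d)} (hξ : ‖ξ‖ = 1) (hw : ‖w‖ = 1)
    (hξp : ∀ i, 0 < ξ i) (hwp : ∀ i, 0 < w i) {r : ℝ} (hr : 0 < r)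
    (h : Real.arccos (∑ i, ξ i * w i) < r) (i : Fin d) : w i ∈ Set.Icc (ξ i - r) (ξ i + r) := by
  have hip := ip hξ hw
  set x := ∑ i, ξ i * w i with hx
  have hx0 : 0 ≤ x := Finset.sum_nonneg fun i _ => (mul_pos (hξp i) (hwp i)).le
  have hs : (w i - ξ i) ^ 2 ≤ ∑ i, (w i - ξ i) ^ 2 :=
    Finset.single_le_sum (f := fun i => (w i - ξ i) ^ 2) (fun i _ => sq_nonneg _) (Finset.mem_univ i)
  have hx1 : x ≤ 1 := by nlinarith [sq_nonneg (w i - ξ i)]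
  have hc := Real.cos_arccos (by linarith) hx1
  have hb := Real.one_sub_sq_div_two_le_cos (x := Real.arccos x)
  rw [hc] at hb
  have ha := Real.arccos_nonneg x
  have : (w i - ξ i) ^ 2 ≤ r ^ 2 := by nlinarith
  have := abs_le_of_sq_le_sq' this hr.le
  constructor <;> linarith [this.1, this.2]

lemma arccos_small {d : ℕ} {ξ w : EuclideanSpace ℝ (Fin d)} (hξ : ‖ξ‖ = 1) (hw : ‖w‖ = 1)
    {r : ℝ} (hr : 0 < r) (h : ∑ i, (w i - ξ i) ^ 2 ≤ r ^ 2 / 100) :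
    Real.arccos (∑ i, ξ i * w i) < r := by
  have hip := ip hξ hw
  have hn : 0 ≤ ∑ i, (w i - ξ i) ^ 2 := Finset.sum_nonneg fun i _ => sq_nonneg _
  set x := ∑ i, ξ i * w i with hx
  rcases lt_or_ge Real.pi r with hp | hp
  · exact (Real.arccos_le_pi _).trans_lt hp
  · have hc := Real.cos_le_one_sub_mul_cos_sq (x := r) (by rwa [abs_of_pos hr])
    have h8 : 1 / 8 ≤ 2 / Real.pi ^ 2 := by
      rw [div_le_div_iff₀ (by norm_num) (by positivity)]
      nlinarith [Real.pi_pos, Real.pi_le_four]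
    have : Real.cos r < x := by nlinarith [mul_le_mul_of_nonneg_right h8 (sq_nonneg r), sq_pos_of_pos hr]
    have := Real.arccos_lt_arccos (Real.neg_one_le_cos r) this (by linarith)
    rwa [Real.arccos_cos hr.le hp] at this

lemma exists_big {n : ℕ} {w : EuclideanSpace ℝ (Fin (n+1))} (h : ‖w‖ = 1) (hp : ∀ i, 0 < w i) :
    ∃ k, 1 / ((n:ℝ) + 1) ≤ w k ^ 2 ∧ 1 / ((n:ℝ) + 1) ≤ w k := by
  have hs := sumsq h
  obtain ⟨k, -, hk⟩ := Finset.exists_le_of_sum_le (s := (Finset.univ : Finset (Fin (n+1))))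
    (f := fun _ => 1 / ((n:ℝ) + 1)) (g := fun i => w i ^ 2) Finset.univ_nonempty (by
      rw [hs]; simp; field_simp; rfl)
  refine ⟨k, hk, hk.trans ?_⟩
  have : w k ^ 2 ≤ 1 := by
    rw [← hs]
    exact Finset.single_le_sum (f := fun i => w i ^ 2) (fun i _ => sq_nonneg _) (Finset.mem_univ k)
  have : w k ≤ 1 := by nlinarith [hp k]
  nlinarith [hp k]

def PP {n : ℕ} (k : Fin (n+1)) (w : EuclideanSpace ℝ (Fin (n+1))) : Fin n → ℝ :=
  fun j => w (k.succAbove j)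

lemma PP_lip {n : ℕ} (k : Fin (n+1)) : LipschitzWith 1 (PP k) := by
  apply LipschitzWith.of_dist_le_mul
  intro w w'
  rw [NNReal.coe_one, one_mul, dist_pi_le_iff dist_nonneg]
  intro j
  have := PiLp.norm_apply_le (w - w') (k.succAbove j)
  simpa [PP, dist_eq_norm] using this

lemma PP_anti {n : ℕ} (k : Fin (n+1)) (w w' : EuclideanSpace ℝ (Fin (n+1)))
    (h : ‖w‖ = 1) (h' : ‖w'‖ = 1) (hp : ∀ i, 0 < w i) (hp' : ∀ i, 0 < w' i)
    (hk : 1 / ((n:ℝ) + 1) ≤ w k) (hk' : 1 / ((n:ℝ) + 1) ≤ w' k) :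
    dist w w' ≤ ((n:ℝ) + 1) ^ 2 * dist (PP k w) (PP k w') := by
  set D := dist (PP k w) (PP k w') with hD
  have hD0 : 0 ≤ D := dist_nonneg
  have hj : ∀ j, |w (k.succAbove j) - w' (k.succAbove j)| ≤ D := fun j => by
    have := dist_le_pi_dist (PP k w) (PP k w') j
    rwa [Real.dist_eq] at this
  have hs := sumsq h
  have hs' := sumsq h'
  have le1 : ∀ v : EuclideanSpace ℝ (Fin (n+1)), ‖v‖ = 1 → ∀ i, v i ≤ 1 := fun v hv i => by
    have := PiLp.norm_apply_le v i
    rw [hv] at this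
    exact (le_abs_self _).trans this
  rw [Fin.sum_univ_succAbove _ k] at hs hs'
  have hb : |∑ j : Fin n, (w (k.succAbove j) ^ 2 - w' (k.succAbove j) ^ 2)| ≤ n * (2 * D) := by
    refine (Finset.abs_sum_le_sum_abs _ _).trans ?_
    refine (Finset.sum_le_card_nsmul _ _ (2 * D) ?_).trans (by simp)
    intro j _
    rw [sq_sub_sq, abs_mul]
    have h1 := le1 w h (k.succAbove j)
    have h2 := le1 w' h' (k.succAbove j)
    have h3 := hp (k.succAbove j)
    have h4 := hp' (k.succAbove j)
    have : |w (k.succAbove j) + w' (k.succAbove j)| ≤ 2 := by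
      rw [abs_of_pos (by linarith)]; linarith
    exact mul_le_mul this (hj j) (abs_nonneg _) (by norm_num)
  rw [Finset.sum_sub_distrib] at hb
  have hb2 : |w k - w' k| * (w k + w' k) ≤ n * (2 * D) := by
    have e : ∑ x, w (k.succAbove x) ^ 2 - ∑ x, w' (k.succAbove x) ^ 2
        = -((w k - w' k) * (w k + w' k)) := by linarith
    rw [e, abs_neg, abs_mul, abs_of_pos (show 0 < w k + w' k by linarith [hp k, hp' k])] at hb
    exact hb
  have hn : (0:ℝ) ≤ n := Nat.cast_nonneg n
  have hb3 : |w k - w' k| ≤ n * (n + 1) * D := by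
    have h1 : |w k - w' k| * (2 * (1 / ((n:ℝ) + 1))) ≤ n * (2 * D) :=
      (mul_le_mul_of_nonneg_left (by linarith) (abs_nonneg _)).trans hb2
    have h2 : |w k - w' k| * (2 * (1 / ((n:ℝ) + 1))) = (2 * |w k - w' k|) / (n + 1) := by ring
    rw [h2, div_le_iff₀ (by positivity)] at h1
    linarith
  rw [EuclideanSpace.dist_eq]
  apply Real.sqrt_le_iff.2
  refine ⟨by positivity, ?_⟩
  rw [Fin.sum_univ_succAbove _ k]
  have hA : dist (w k) (w' k) ^ 2 ≤ (n * (n + 1) * D) ^ 2 := by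
    rw [Real.dist_eq]; gcongr
  have hB : ∑ j : Fin n, dist (w (k.succAbove j)) (w' (k.succAbove j)) ^ 2 ≤ n * D ^ 2 := by
    refine (Finset.sum_le_card_nsmul _ _ (D ^ 2) ?_).trans (by simp)
    intro j _
    rw [Real.dist_eq]
    have := hj j
    gcongr
  refine (add_le_add hA hB).trans ?_
  have : 0 ≤ D ^ 2 * (n ^ 2 + 2 * n ^ 3 + 4 * n ^2 + 3 * n + 1) := by positivity
  nlinarith [mul_nonneg (sq_nonneg D) hn, mul_nonneg (sq_nonneg D) (pow_nonneg hn 2), mul_nonneg (sq_nonneg D) (pow_nonneg hn 3), sq_nonneg D]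

lemma upper (n : ℕ) (γ : Fin (n+1) → ℝ) (hγ : ∀ i, -1 < γ i) : ∃ C : ℝ, 0 < C ∧
    ∀ ξ : EuclideanSpace ℝ (Fin (n+1)), ‖ξ‖ = 1 → (∀ i, 0 < ξ i) →
      ∀ r : ℝ, 0 < r → r ≤ 2 * Real.pi →
        (∫⁻ w in {w : EuclideanSpace ℝ (Fin (n+1)) |
              ‖w‖ = 1 ∧ (∀ i, 0 < w i) ∧ Real.arccos (∑ i, ξ i * w i) < r},
            ENNReal.ofReal ((∏ i, (w i + r) ^ (-γ i)) * ∏ i, (w i) ^ γ i)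
              ∂(μH[(n : ℝ)])) ≤ ENNReal.ofReal (C * r ^ n) := by
  choose Cf hC0 hC using fun i => one_d (γ i) (hγ i)
  set m : ℝ := 1 / (1 + 8 * ((n:ℝ) + 1)) with hm
  have hm0 : 0 < m := by positivity
  set B : Fin (n+1) → ℝ := fun k =>
    m⁻¹ ^ |γ k| * ((((n:ℝ) + 1) ^ 2) ^ n * ∏ j, Cf (k.succAbove j)) with hB
  have hB0 : ∀ k, 0 < B k := fun k => by
    have : 0 < ∏ j, Cf (k.succAbove j) := Finset.prod_pos fun j _ => hC0 _
    positivity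
  refine ⟨∑ k, B k, Finset.sum_pos (fun k _ => hB0 k) Finset.univ_nonempty, ?_⟩
  intro ξ hξ hξp r hr hr2
  have hr8 : r ≤ 8 := by linarith [Real.pi_le_four]
  set T : Fin (n+1) → Set (EuclideanSpace ℝ (Fin (n+1))) := fun k =>
    {w | (‖w‖ = 1 ∧ (∀ i, 0 < w i) ∧ Real.arccos (∑ i, ξ i * w i) < r) ∧ 1 / ((n:ℝ) + 1) ≤ w k} with hT
  have hsub : {w : EuclideanSpace ℝ (Fin (n+1)) |
              ‖w‖ = 1 ∧ (∀ i, 0 < w i) ∧ Real.arccos (∑ i, ξ i * w i) < r} ⊆ ⋃ k, T k := by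
    intro w hw
    obtain ⟨k, -, hk⟩ := exists_big hw.1 hw.2.1
    exact Set.mem_iUnion.2 ⟨k, hw, hk⟩
  refine (lintegral_mono_set hsub).trans ?_
  refine (lintegral_iUnion_le _ _).trans ?_
  rw [tsum_fintype, Finset.sum_mul, ENNReal.ofReal_sum_of_nonneg
    (fun k _ => mul_nonneg (hB0 k).le (by positivity))]
  refine Finset.sum_le_sum fun k _ => ?_
  set g : (Fin n → ℝ) → ENNReal := fun y => ∏ j, ENNReal.ofReal
    ((y j + r) ^ (-γ (k.succAbove j)) * (y j) ^ γ (k.succAbove j)) with hg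
  have hfm : ∀ j : Fin n, Measurable (fun t : ℝ => ENNReal.ofReal
    ((t + r) ^ (-γ (k.succAbove j)) * t ^ γ (k.succAbove j))) := fun j => by fun_prop
  have hgm : Measurable g :=
    Finset.measurable_prod _ fun j _ => (hfm j).comp (measurable_pi_apply j)
  have hPm : Measurable (PP k) := (PP_lip k).continuous.measurable
  set I : Fin n → Set ℝ := fun j =>
    Set.Ioi 0 ∩ Set.Icc (ξ (k.succAbove j) - r) (ξ (k.succAbove j) + r) with hI
  calc _ ≤ ∫⁻ w in T k, ENNReal.ofReal (m⁻¹ ^ |γ k|) * g (PP k w) ∂μH[(n:ℝ)] := by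
        refine setLIntegral_mono ((hgm.comp hPm).const_mul _) ?_
        rintro w ⟨⟨-, hwp, -⟩, hwk⟩
        have hfac := (fac (γ k) (w k) r m (hwp k) hr hm0 (by
          rw [hm, one_div_mul_eq_div, div_le_iff₀ (by positivity)]
          rw [div_le_iff₀ (by positivity)] at hwk
          nlinarith)).2
        rw [← Finset.prod_mul_distrib, Fin.prod_univ_succAbove _ k, ENNReal.ofReal_mul (by
          have := hwp k; positivity), ENNReal.ofReal_prod_of_nonneg (fun j _ => by
          have := hwp (k.succAbove j); positivity)]
        exact mul_le_mul_left (ENNReal.ofReal_le_ofReal hfac) _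
    _ = ENNReal.ofReal (m⁻¹ ^ |γ k|) * ∫⁻ w in T k, g (PP k w) ∂μH[(n:ℝ)] :=
        lintegral_const_mul _ (hgm.comp hPm)
    _ ≤ ENNReal.ofReal (m⁻¹ ^ |γ k|) * (((((n:NNReal) + 1)^2 : NNReal) : ENNReal) ^ (n:ℝ) *
          ∫⁻ y in Set.pi Set.univ I, g y ∂μH[(n:ℝ)]) := by
        gcongr
        refine lint_le (PP k) hPm (T k) (Set.pi Set.univ I) ?_ _ ?_ n (Nat.cast_nonneg n) g hgm
        · rintro w ⟨⟨hw, hwp, hwa⟩, hwk⟩ j -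
          exact ⟨hwp _, coord_close hξ hw hξp hwp hr hwa _⟩
        · rintro w ⟨⟨hw, hwp, hwa⟩, hwk⟩ w' ⟨⟨hw', hwp', hwa'⟩, hwk'⟩
          have := PP_anti k w w' hw hw' hwp hwp' hwk hwk'
          push_cast
          exact this
    _ ≤ ENNReal.ofReal (m⁻¹ ^ |γ k|) * (((((n:NNReal) + 1)^2 : NNReal) : ENNReal) ^ (n:ℝ) *
          ∏ j, ENNReal.ofReal (Cf (k.succAbove j) * r)) := by
        gcongr
        have hv : (μH[(n:ℝ)] : Measure (Fin n → ℝ)) = volume := by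
          have := hausdorffMeasure_pi_real (ι := Fin n)
          rwa [Fintype.card_fin] at this
        rw [hv, volume_pi, Measure.restrict_pi_pi, hg]
        rw [lint_prod n _ (fun j t => ENNReal.ofReal
          ((t + r) ^ (-γ (k.succAbove j)) * t ^ γ (k.succAbove j))) hfm]
        exact Finset.prod_le_prod' fun j _ => hC _ _ _ hr
    _ = ENNReal.ofReal (B k * r ^ n) := by
        rw [← ENNReal.ofReal_prod_of_nonneg (fun j _ => (mul_pos (hC0 _) hr).le),
          Finset.prod_mul_distrib, Finset.prod_const, Finset.card_univ, Fintype.card_fin,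
          ENNReal.rpow_natCast]
        have : ((((n:NNReal) + 1)^2 : NNReal) : ENNReal) = ENNReal.ofReal (((n:ℝ)+1)^2) := by
          rw [ENNReal.ofReal, Real.toNNReal_of_nonneg (by positivity)]
          congr 1
        rw [this, ← ENNReal.ofReal_pow (by positivity), ← ENNReal.ofReal_mul (by positivity),
          ← ENNReal.ofReal_mul (by positivity)]
        congr 1
        simp only [hB]
        ring

set_option maxHeartbeats 1600000 in
lemma lower (n : ℕ) (γ : Fin (n+1) → ℝ) : ∃ C : ℝ, 0 < C ∧
    ∀ ξ : EuclideanSpace ℝ (Fin (n+1)), ‖ξ‖ = 1 → (∀ i, 0 < ξ i) →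
      ∀ r : ℝ, 0 < r → r ≤ 2 * Real.pi →
        ENNReal.ofReal (C * r ^ n) ≤ (∫⁻ w in {w : EuclideanSpace ℝ (Fin (n+1)) |
              ‖w‖ = 1 ∧ (∀ i, 0 < w i) ∧ Real.arccos (∑ i, ξ i * w i) < r},
            ENNReal.ofReal ((∏ i, (w i + r) ^ (-γ i)) * ∏ i, (w i) ^ γ i)
              ∂(μH[(n : ℝ)])) := by
  set N : ℝ := (n:ℝ) + 1 with hN
  have hn0 : (0:ℝ) ≤ n := Nat.cast_nonneg n
  have hN1 : 1 ≤ N := by linarith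
  have hN2 : 1 ≤ N ^ 2 := by nlinarith
  set m : ℝ := 1 / (1 + 96 * N ^ 2) with hm
  have hm0 : 0 < m := by positivity
  set c : ℝ := ∏ i, m ^ |γ i| with hc
  have hc0 : 0 < c := Finset.prod_pos fun i _ => by positivity
  refine ⟨c * (1 / (96 * N ^ 2)) ^ n, by positivity, ?_⟩
  intro ξ hξ hξp r hr hr2
  have hr8 : r ≤ 8 := by linarith [Real.pi_le_four]
  obtain ⟨k, hk2, hk⟩ := exists_big hξ hξp
  rw [← hN] at hk2 hk
  set δ : ℝ := r / (48 * N ^ 2) with hδ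
  have hδ0 : 0 < δ := by positivity
  have hδr : 48 * N ^ 2 * δ = r := by rw [hδ]; field_simp
  have hδ6 : 6 * N ^ 2 * δ ≤ 1 := by nlinarith
  have hδ1 : δ ≤ 1 := by nlinarith
  have hNi : N * (1 / N) = 1 := by field_simp
  have hNi0 : 0 < 1 / N := by positivity
  have h3 : 3 * n * δ ≤ 1 / (2 * N) := by
    rw [le_div_iff₀ (by positivity)]
    nlinarith [mul_nonneg hδ0.le (by linarith : (0:ℝ) ≤ N)]
  have hξ1 : ∀ i, ξ i ≤ 1 := fun i => by
    have := PiLp.norm_apply_le ξ i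
    rw [hξ] at this
    exact (le_abs_self _).trans this
  have hξs := sumsq hξ
  rw [Fin.sum_univ_succAbove _ k] at hξs
  set J : Fin n → Set ℝ := fun j => Set.Ioo (ξ (k.succAbove j) + δ / 2) (ξ (k.succAbove j) + δ) with hJ
  have hJs : ∀ y : Fin n → ℝ, (∀ j, y j ∈ J j) →
      0 ≤ ∑ j, y j ^ 2 - ∑ j, ξ (k.succAbove j) ^ 2 ∧
      ∑ j, y j ^ 2 - ∑ j, ξ (k.succAbove j) ^ 2 ≤ 3 * n * δ := by
    intro y hy
    rw [← Finset.sum_sub_distrib]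
    constructor
    · refine Finset.sum_nonneg fun j _ => ?_
      have := (hy j).1
      have := hξp (k.succAbove j)
      nlinarith
    · refine (Finset.sum_le_card_nsmul _ _ (3 * δ) ?_).trans (by simp; linarith)
      intro j _
      have h1 := (hy j).1
      have h2 := (hy j).2
      have h3 := hξp (k.succAbove j)
      have h4 := hξ1 (k.succAbove j)
      nlinarith
  set S : Set (EuclideanSpace ℝ (Fin (n+1))) :=
    {w | ‖w‖ = 1 ∧ (∀ j, w (k.succAbove j) ∈ J j) ∧ 1 / (2 * N) ≤ w k} with hS
  have hSm : MeasurableSet S := by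
    have hco : ∀ i : Fin (n+1), Measurable fun w : EuclideanSpace ℝ (Fin (n+1)) => w i :=
      fun i => by fun_prop
    refine MeasurableSet.inter (measurableSet_eq_fun measurable_norm measurable_const) ?_
    refine MeasurableSet.inter ?_ (measurableSet_le measurable_const (hco k))
    change MeasurableSet {w : EuclideanSpace ℝ (Fin (n+1)) | ∀ j, w (k.succAbove j) ∈ J j}
    rw [Set.ofPred_forall]
    exact MeasurableSet.iInter fun j => hco _ measurableSet_Ioo
  have hSpos : ∀ w ∈ S, ∀ i, δ / 2 ≤ w i := by
    rintro w ⟨-, hwj, hwk⟩ i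
    rcases Fin.eq_self_or_eq_succAbove k i with rfl | ⟨j, rfl⟩
    · refine le_trans ?_ hwk
      rw [le_div_iff₀ (by positivity)]
      nlinarith
    · have := (hwj j).1
      have := hξp (k.succAbove j)
      linarith
  have hSsub : S ⊆ {w : EuclideanSpace ℝ (Fin (n+1)) |
              ‖w‖ = 1 ∧ (∀ i, 0 < w i) ∧ Real.arccos (∑ i, ξ i * w i) < r} := by
    intro w hwS
    have hwpos : ∀ i, 0 < w i := fun i => lt_of_lt_of_le (by positivity) (hSpos w hwS i)
    obtain ⟨hw, hwj, hwk⟩ := hwS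
    refine ⟨hw, hwpos, arccos_small hξ hw hr ?_⟩
    have hws := sumsq hw
    rw [Fin.sum_univ_succAbove _ k] at hws ⊢
    obtain ⟨hd1, hd2⟩ := hJs (fun j => w (k.succAbove j)) hwj
    have hwp := hwpos k
    have hdiff : (ξ k - w k) * (ξ k + w k) =
      ∑ j, w (k.succAbove j) ^ 2 - ∑ j, ξ (k.succAbove j) ^ 2 := by linarith
    have hge : 0 ≤ ξ k - w k := by
      by_contra hh
      nlinarith [hξp k]
    have hle : ξ k - w k ≤ 3 * N ^ 2 * δ := by
      have h1 : (ξ k - w k) * (1 / N) ≤ 3 * n * δ := by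
        have : (ξ k - w k) * (1 / N) ≤ (ξ k - w k) * (ξ k + w k) :=
          mul_le_mul_of_nonneg_left (by linarith) hge
        linarith
      rw [mul_one_div, div_le_iff₀ (by positivity)] at h1
      have h5 : 3 * n * δ * N ≤ 3 * N * δ * N := by
        have : (n:ℝ) ≤ N := by linarith
        gcongr
      calc ξ k - w k ≤ 3 * N * δ * N := h1.trans h5
        _ = 3 * N ^ 2 * δ := by ring
    have hle2 : ξ k - w k ≤ r / 16 := by linarith
    have hA : (w k - ξ k) ^ 2 ≤ (r / 16) ^ 2 := by nlinarith
    have hBB : ∑ j : Fin n, (w (k.succAbove j) - ξ (k.succAbove j)) ^ 2 ≤ n * δ ^ 2 := by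
      refine (Finset.sum_le_card_nsmul _ _ (δ ^ 2) ?_).trans (by simp)
      intro j _
      have h1 := (hwj j).1
      have h2 := (hwj j).2
      nlinarith
    have hCC : n * δ ^ 2 ≤ (r / 48) ^ 2 := by
      have : r / 48 = N ^ 2 * δ := by linarith
      rw [this, mul_pow]
      have : (n:ℝ) ≤ (N ^ 2) ^ 2 := by nlinarith
      gcongr
    nlinarith
  have hv : (μH[(n:ℝ)] : Measure (Fin n → ℝ)) = volume := by
    have := hausdorffMeasure_pi_real (ι := Fin n)
    rwa [Fintype.card_fin] at this
  have himg : Set.pi Set.univ J ⊆ PP k '' S := by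
    intro y hy
    have hy : ∀ j, y j ∈ J j := fun j => hy j trivial
    obtain ⟨hd1, hd2⟩ := hJs y hy
    have hge : 1 / (2 * N) ≤ 1 - ∑ j, y j ^ 2 := by
      have : 1 / N = 1 / (2 * N) + 1 / (2 * N) := by field_simp; norm_num
      linarith
    have h0 : 0 < 1 / (2 * N) := by positivity
    have hle1 : 1 - ∑ j, y j ^ 2 ≤ 1 := by
      have : 0 ≤ ∑ j, y j ^ 2 := Finset.sum_nonneg fun j _ => sq_nonneg _
      linarith
    set z := Real.sqrt (1 - ∑ j, y j ^ 2) with hz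
    have hzz : z ^ 2 = 1 - ∑ j, y j ^ 2 := Real.sq_sqrt (by linarith)
    have hz1 : z ≤ 1 := Real.sqrt_le_one.2 hle1
    have hz0 : 0 ≤ z := Real.sqrt_nonneg _
    refine ⟨WithLp.toLp 2 (k.insertNth z y : Fin (n+1) → ℝ), ⟨?_, ?_, ?_⟩, ?_⟩
    · rw [EuclideanSpace.norm_eq, Real.sqrt_eq_one, Fin.sum_univ_succAbove _ k]
      simp [hzz]
    · intro j
      simpa using hy j
    · simp only [Fin.insertNth_apply_same]
      nlinarith
    · ext j
      simp [PP]
  have hvol : ENNReal.ofReal ((1 / (96 * N ^ 2)) ^ n * r ^ n) ≤ μH[(n:ℝ)] S := by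
    calc ENNReal.ofReal ((1 / (96 * N ^ 2)) ^ n * r ^ n) = volume (Set.pi Set.univ J) := by
          rw [Real.volume_pi_Ioo]
          rw [Finset.prod_congr rfl (fun j _ => by
            rw [show ξ (k.succAbove j) + δ - (ξ (k.succAbove j) + δ / 2) = 1 / (96 * N ^ 2) * r by
              rw [hδ]; field_simp; ring])]
          rw [Finset.prod_const, Finset.card_univ, Fintype.card_fin,
            ← ENNReal.ofReal_pow (by positivity), mul_pow]
      _ ≤ volume (PP k '' S) := measure_mono himg
      _ ≤ μH[(n:ℝ)] S := by
          rw [← hv]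
          simpa using (PP_lip k).hausdorffMeasure_image_le hn0 S
  calc ENNReal.ofReal (c * (1 / (96 * N ^ 2)) ^ n * r ^ n)
      = ENNReal.ofReal c * ENNReal.ofReal ((1 / (96 * N ^ 2)) ^ n * r ^ n) := by
        rw [← ENNReal.ofReal_mul hc0.le]; congr 1; ring
    _ ≤ ENNReal.ofReal c * μH[(n:ℝ)] S := by gcongr
    _ = ∫⁻ w in S, ENNReal.ofReal c ∂μH[(n:ℝ)] := by simp
    _ ≤ ∫⁻ w in S, ENNReal.ofReal ((∏ i, (w i + r) ^ (-γ i)) * ∏ i, (w i) ^ γ i) ∂μH[(n:ℝ)] := by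
        refine setLIntegral_mono' hSm fun w hw => ENNReal.ofReal_le_ofReal ?_
        rw [← Finset.prod_mul_distrib]
        refine Finset.prod_le_prod (fun i _ => by positivity) fun i _ => ?_
        have h1 := hSpos w hw i
        refine (fac (γ i) (w i) r m (by linarith) hr hm0 ?_).1
        rw [hm, one_div_mul_eq_div, div_le_iff₀ (by positivity)]
        nlinarith
    _ ≤ _ := lintegral_mono_set hSsub


/-- For fixed `d ≥ 2` and `γ ∈ (−1,∞)^d` there exist `0 < c₁ ≤ c₂` such that
for every `ξ ∈ S^{d−1}_+` and every `0 < r ≤ 2π`,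
`c₁ r^{d−1} ≤ ∫_{c⁺(ξ,r)} (∏ (w_i + r)^{−γ_i}) w^γ dσ(w) ≤ c₂ r^{d−1}`,
where `σ` is the natural `(d−1)`-dimensional surface (Hausdorff) measure on the unit sphere,
`c⁺(ξ,r) = {w ∈ S^{d−1}_+ : arccos⟨ξ,w⟩ < r}` and `w^γ = ∏ w_i^{γ_i}`. -/
theorem stmt4 (d : ℕ) (hd : 2 ≤ d) (γ : Fin d → ℝ) (hγ : ∀ i, -1 < γ i) :
    ∃ c₁ c₂ : ℝ, 0 < c₁ ∧ c₁ ≤ c₂ ∧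
      ∀ ξ : EuclideanSpace ℝ (Fin d), ‖ξ‖ = 1 → (∀ i, 0 < ξ i) →
        ∀ r : ℝ, 0 < r → r ≤ 2 * Real.pi →
          ENNReal.ofReal (c₁ * r ^ (d - 1)) ≤
            (∫⁻ w in {w : EuclideanSpace ℝ (Fin d) |
                ‖w‖ = 1 ∧ (∀ i, 0 < w i) ∧ Real.arccos (∑ i, ξ i * w i) < r},
              ENNReal.ofReal ((∏ i, (w i + r) ^ (-γ i)) * ∏ i, (w i) ^ γ i)
                ∂(μH[(d - 1 : ℝ)])) ∧
          (∫⁻ w in {w : EuclideanSpace ℝ (Fin d) |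
              ‖w‖ = 1 ∧ (∀ i, 0 < w i) ∧ Real.arccos (∑ i, ξ i * w i) < r},
            ENNReal.ofReal ((∏ i, (w i + r) ^ (-γ i)) * ∏ i, (w i) ^ γ i)
              ∂(μH[(d - 1 : ℝ)])) ≤
            ENNReal.ofReal (c₂ * r ^ (d - 1)) := by
  obtain ⟨n, rfl⟩ : ∃ n, d = n + 1 := ⟨d - 1, by omega⟩
  obtain ⟨C₁, h1, hl⟩ := lower n γ
  obtain ⟨C₂, h2, hu⟩ := upper n γ hγ
  have e : (((n + 1 : ℕ) : ℝ) - 1) = n := by push_cast; ring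
  refine ⟨C₁, max C₁ C₂, h1, le_max_left _ _, ?_⟩
  intro ξ hξ hξp r hr hr2
  rw [e, Nat.add_sub_cancel]
  refine ⟨hl ξ hξ hξp r hr hr2, (hu ξ hξ hξp r hr hr2).trans (ENNReal.ofReal_le_ofReal ?_)⟩
  gcongr
  exact le_max_right _ _
end

section
/- Let d ≥ 2 and γ ∈ (−1,∞)^d be fixed. Then there exist constants 0 < c₁ ≤ c₂ (depending only on d and γ) such that for all 0 ≤ a ≤ b ≤ ∞ (with b = ∞ interpreted as an improper integral), c₁ M ≤ ∫_{{z ∈ (0,∞)^d : a ≤ |z| ≤ b}} z^γ e^{−|z|²} dz ≤ c₂ M, where M = [min(b − a, 1/(a+1))] · [min(b, a+1)]^{⟨γ⟩ + d − 1} · e^{−a²} and ⟨γ⟩ = γ_1 + ⋯ + γ_d. -/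
open MeasureTheory

noncomputable def nrm {d : ℕ} (z : Fin d → ℝ) : ℝ := Real.sqrt (∑ i, z i ^ 2)

lemma nrm_meas {d : ℕ} : Measurable (nrm (d := d)) := by
  unfold nrm; fun_prop

lemma nrm_nonneg {d : ℕ} (z : Fin d → ℝ) : 0 ≤ nrm z := Real.sqrt_nonneg _

lemma nrm_smul {d : ℕ} {r : ℝ} (hr : 0 ≤ r) (z : Fin d → ℝ) : nrm (r • z) = r * nrm z := by
  unfold nrm
  simp only [Pi.smul_apply, smul_eq_mul, mul_pow, ← Finset.mul_sum]
  rw [Real.sqrt_mul (sq_nonneg r), Real.sqrt_sq hr]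

/-- weight -/
noncomputable def wt {d : ℕ} (γ : Fin d → ℝ) (z : Fin d → ℝ) : ENNReal :=
  ENNReal.ofReal (∏ i, z i ^ γ i)

lemma wt_meas {d : ℕ} (γ : Fin d → ℝ) : Measurable (wt γ) := by
  unfold wt; fun_prop

def psh (d : ℕ) (S : Set ℝ) : Set (Fin d → ℝ) := {z | (∀ i, 0 < z i) ∧ nrm z ∈ S}

lemma psh_meas {d : ℕ} {S : Set ℝ} (hS : MeasurableSet S) : MeasurableSet (psh d S) := by
  have h1 : MeasurableSet {z : Fin d → ℝ | ∀ i, 0 < z i} := by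
    rw [Set.ofPred_forall]
    exact MeasurableSet.iInter fun i => measurableSet_lt measurable_const (measurable_pi_apply i)
  exact h1.inter (nrm_meas hS)

lemma ball_scale {d : ℕ} (γ : Fin d → ℝ) {r : ℝ} (hr : 0 < r) :
    ∫⁻ z in psh d (Set.Iic r), wt γ z =
      ENNReal.ofReal (r ^ ((∑ i, γ i) + d)) * ∫⁻ z in psh d (Set.Iic 1), wt γ z := by
  have hm := Measure.map_addHaar_smul (volume : Measure (Fin d → ℝ)) hr.ne'
  have key : ∫⁻ z, (psh d (Set.Iic r)).indicator (wt γ) (r • z) =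
      ENNReal.ofReal (|(r ^ d)⁻¹|) * ∫⁻ z, (psh d (Set.Iic r)).indicator (wt γ) z := by
    rw [← lintegral_map (μ := volume) (g := fun z : Fin d → ℝ => r • z)
      ((wt_meas γ).indicator (psh_meas measurableSet_Iic)) (measurable_const_smul r), hm]
    simp
  have h2 : ∀ z, (psh d (Set.Iic r)).indicator (wt γ) (r • z) =
      ENNReal.ofReal (r ^ (∑ i, γ i)) * (psh d (Set.Iic 1)).indicator (wt γ) z := by
    intro z
    have hiff : r • z ∈ psh d (Set.Iic r) ↔ z ∈ psh d (Set.Iic 1) := by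
      simp only [psh, Set.mem_ofPred_eq, nrm_smul hr.le, Pi.smul_apply, smul_eq_mul, Set.mem_Iic]
      refine and_congr (forall_congr' fun i => ?_) ?_
      · exact mul_pos_iff_of_pos_left hr
      · constructor
        · intro h; nlinarith
        · intro h; nlinarith
    by_cases hz : z ∈ psh d (Set.Iic 1)
    · rw [Set.indicator_of_mem hz, Set.indicator_of_mem (hiff.2 hz)]
      unfold wt
      rw [← ENNReal.ofReal_mul (by positivity)]
      congr 1
      simp only [Pi.smul_apply, smul_eq_mul]
      rw [Real.rpow_sum_of_pos hr, ← Finset.prod_mul_distrib]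
      exact Finset.prod_congr rfl fun i _ => Real.mul_rpow hr.le (hz.1 i).le
    · rw [Set.indicator_of_notMem hz, Set.indicator_of_notMem (fun h => hz (hiff.1 h))]
      simp
  simp_rw [h2] at key
  rw [lintegral_const_mul _ ((wt_meas γ).indicator (psh_meas measurableSet_Iic)),
    lintegral_indicator (psh_meas measurableSet_Iic),
    lintegral_indicator (psh_meas measurableSet_Iic)] at key
  rw [Real.rpow_add hr, Real.rpow_natCast, mul_comm (r ^ _), ENNReal.ofReal_mul (by positivity),
    mul_assoc, key, ← mul_assoc, ← ENNReal.ofReal_mul (by positivity), abs_of_pos (by positivity),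
    mul_inv_cancel₀ (by positivity)]
  simp

lemma ball_fin {d : ℕ} (γ : Fin d → ℝ) (hγ : ∀ i, -1 < γ i) :
    ∫⁻ z in psh d (Set.Iic 1), wt γ z ≠ ⊤ := by
  have h1 : Integrable (fun z : Fin d → ℝ => ∏ i, (Set.Ioc (0:ℝ) 1).indicator (fun x => x ^ γ i) (z i)) := by
    refine Integrable.fintype_prod (f := fun i => (Set.Ioc (0:ℝ) 1).indicator (fun x => x ^ γ i)) ?_
    intro i
    rw [integrable_indicator_iff measurableSet_Ioc,
      ← intervalIntegrable_iff_integrableOn_Ioc_of_le zero_le_one]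
    exact intervalIntegral.intervalIntegrable_rpow' (hγ i)
  have h2 := h1.lintegral_lt_top
  refine ne_of_lt (lt_of_le_of_lt ?_ h2)
  rw [← lintegral_indicator (psh_meas measurableSet_Iic)]
  refine lintegral_mono fun z => ?_
  by_cases hz : z ∈ psh d (Set.Iic 1)
  swap
  · rw [Set.indicator_of_notMem hz]; simp
  rw [Set.indicator_of_mem hz]
  unfold wt
  apply le_of_eq
  congr 1
  refine Finset.prod_congr rfl fun i _ => ?_
  rw [Set.indicator_of_mem]
  refine ⟨hz.1 i, ?_⟩
  have h3 : z i ^ 2 ≤ ∑ j, z j ^ 2 :=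
    Finset.single_le_sum (f := fun j => z j ^ 2) (fun j _ => sq_nonneg _) (Finset.mem_univ i)
  have h4 : nrm z ≤ 1 := hz.2
  unfold nrm at h4
  rw [Real.sqrt_le_left zero_le_one] at h4
  nlinarith [hz.1 i]

lemma ball_pos {d : ℕ} (γ : Fin d → ℝ) :
    0 < ∫⁻ z in psh d (Set.Iic 1), wt γ z := by
  rw [setLIntegral_pos_iff (wt_meas γ)]
  have hsub : psh d (Set.Iio 1) ⊆ Function.support (wt γ) ∩ psh d (Set.Iic 1) := by
    intro z hz
    refine ⟨?_, hz.1, Set.Iio_subset_Iic_self hz.2⟩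
    simp only [wt, Function.mem_support, ne_eq, ENNReal.ofReal_eq_zero, not_le]
    exact Finset.prod_pos fun i _ => Real.rpow_pos_of_pos (hz.1 i) _
  refine lt_of_lt_of_le ?_ (measure_mono hsub)
  apply IsOpen.measure_pos
  · have h1 : IsOpen {z : Fin d → ℝ | ∀ i, 0 < z i} := by
      rw [Set.ofPred_forall]
      exact isOpen_iInter_of_finite fun i => isOpen_lt continuous_const (continuous_apply i)
    have h2 : IsOpen (nrm (d := d) ⁻¹' Set.Iio 1) := by
      refine isOpen_Iio.preimage ?_
      unfold nrm; fun_prop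
    exact h1.inter h2
  · refine ⟨fun _ => 1 / (d + 1 : ℝ), fun i => by positivity, ?_⟩
    show nrm _ < 1
    unfold nrm
    rw [Real.sqrt_lt' one_pos]
    simp only [Finset.sum_const, Finset.card_univ, Fintype.card_fin, nsmul_eq_mul]
    rw [div_pow, one_pow, mul_one_div, div_lt_iff₀ (by positivity)]
    have : (0:ℝ) ≤ d := by positivity
    nlinarith

lemma shell {d : ℕ} (γ : Fin d → ℝ) (hγ : ∀ i, -1 < γ i) (hp : 0 < (∑ i, γ i) + d) :
    ∃ G : ℝ, 0 < G ∧ ∀ a b, 0 ≤ a → a ≤ b → 0 < b →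
      ∫⁻ z in psh d (Set.Icc a b), wt γ z =
        ENNReal.ofReal (G * (b ^ ((∑ i, γ i) + d) - a ^ ((∑ i, γ i) + d))) := by
  set p := (∑ i, γ i) + d with hpd
  refine ⟨(∫⁻ z in psh d (Set.Iic 1), wt γ z).toReal,
    ENNReal.toReal_pos (ball_pos γ).ne' (ball_fin γ hγ), ?_⟩
  set G := (∫⁻ z in psh d (Set.Iic 1), wt γ z).toReal with hG
  have hGp : 0 < G := ENNReal.toReal_pos (ball_pos γ).ne' (ball_fin γ hγ)
  have hB : ∀ r, 0 < r → ∫⁻ z in psh d (Set.Iic r), wt γ z = ENNReal.ofReal (G * r ^ p) := by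
    intro r hr
    rw [ball_scale γ hr, mul_comm G, ENNReal.ofReal_mul (by positivity), hG,
      ENNReal.ofReal_toReal (ball_fin γ hγ)]
  have hC : ∀ a b, 0 < a → a ≤ b → ∫⁻ z in psh d (Set.Ioc a b), wt γ z =
      ENNReal.ofReal (G * (b ^ p - a ^ p)) := by
    intro a b ha hab
    have hu : psh d (Set.Iic b) = psh d (Set.Iic a) ∪ psh d (Set.Ioc a b) := by
      ext z
      simp only [psh, Set.mem_ofPred_eq, Set.mem_union, Set.mem_Iic, Set.mem_Ioc]
      grind
    have hdj : Disjoint (psh d (Set.Iic a)) (psh d (Set.Ioc a b)) := by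
      rw [Set.disjoint_left]
      intro z h1 h2
      exact absurd h1.2 (not_le.2 h2.2.1)
    have h := hB b (ha.trans_le hab)
    rw [hu, lintegral_union (psh_meas measurableSet_Ioc) hdj, hB a ha] at h
    rw [mul_sub, ENNReal.ofReal_sub _ (by positivity), ← h]
    rw [ENNReal.add_sub_cancel_left ENNReal.ofReal_ne_top]
  intro a b ha hab hb
  rcases ha.eq_or_lt with rfl | ha
  · rw [Real.zero_rpow hp.ne', sub_zero, ← hB b hb]
    congr 2
    ext z
    simp [psh, nrm_nonneg]
  · apply le_antisymm
    · have ht : Filter.Tendsto (fun x : ℝ => ENNReal.ofReal (G * (b ^ p - x ^ p)))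
          (nhdsWithin a (Set.Iio a)) (nhds (ENNReal.ofReal (G * (b ^ p - a ^ p)))) := by
        apply Filter.Tendsto.mono_left _ nhdsWithin_le_nhds
        apply (ENNReal.continuous_ofReal.tendsto _).comp
        apply Filter.Tendsto.const_mul
        apply Filter.Tendsto.const_sub
        exact (Real.continuousAt_rpow_const a p (Or.inl ha.ne')).tendsto
      refine ge_of_tendsto ht ?_
      filter_upwards [Ioo_mem_nhdsLT ha] with x hx
      rw [← hC x b hx.1 (hx.2.le.trans hab)]
      refine lintegral_mono_set fun z hz => ⟨hz.1, lt_of_lt_of_le hx.2 hz.2.1, hz.2.2⟩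
    · rw [← hC a b ha hab]
      refine lintegral_mono_set fun z hz => ⟨hz.1, hz.2.1.le, hz.2.2⟩

lemma diff_rpow {p a b : ℝ} (hp : 0 < p) (ha : 0 ≤ a) (hab : a ≤ b) (hb : 0 < b) :
    min 1 p * ((b - a) * b ^ (p - 1)) ≤ b ^ p - a ^ p ∧
      b ^ p - a ^ p ≤ max 1 p * ((b - a) * b ^ (p - 1)) := by
  obtain ⟨t, rfl⟩ : ∃ t, a = b * t := ⟨a / b, by field_simp⟩
  have ht0 : 0 ≤ t := by
    by_contra h
    push Not at h
    nlinarith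
  have ht1 : t ≤ 1 := by
    by_contra h
    push Not at h
    nlinarith
  have hbp : 0 < b ^ p := by positivity
  have e1 : (b - b * t) * b ^ (p - 1) = b ^ p * (1 - t) := by
    rw [Real.rpow_sub_one hb.ne']; field_simp
  have e2 : b ^ p - (b * t) ^ p = b ^ p * (1 - t ^ p) := by
    rw [Real.mul_rpow hb.le ht0]; ring
  rw [e1, e2]
  suffices h : min 1 p * (1 - t) ≤ 1 - t ^ p ∧ 1 - t ^ p ≤ max 1 p * (1 - t) by
    constructor
    · calc _ = b ^ p * (min 1 p * (1 - t)) := by ring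
        _ ≤ _ := mul_le_mul_of_nonneg_left h.1 hbp.le
    · calc _ ≤ b ^ p * (max 1 p * (1 - t)) := mul_le_mul_of_nonneg_left h.2 hbp.le
        _ = _ := by ring
  rcases le_total 1 p with h1 | h1
  · rw [min_eq_left h1, max_eq_right h1]
    have h2 := one_add_mul_self_le_rpow_one_add (s := t - 1) (by linarith) h1
    have h3 : t ^ p ≤ t ^ (1:ℝ) := Real.rpow_le_rpow_of_exponent_ge' ht0 ht1 zero_le_one h1
    rw [Real.rpow_one] at h3
    rw [add_sub_cancel] at h2
    constructor <;> linarith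
  · rw [min_eq_right h1, max_eq_left h1]
    have h2 := rpow_one_add_le_one_add_mul_self (s := t - 1) (by linarith) hp.le h1
    have h3 : t ^ (1:ℝ) ≤ t ^ p := Real.rpow_le_rpow_of_exponent_ge' ht0 ht1 hp.le h1
    rw [Real.rpow_one] at h3
    rw [add_sub_cancel] at h2
    constructor <;> linarith

lemma cmp_rpow {s x y A : ℝ} {n : ℕ} (hn : |s| ≤ n) (hA : 1 ≤ A) (hx : 0 < x) (hy : 0 < y)
    (h1 : x ≤ A * y) (h2 : y ≤ A * x) : x ^ s ≤ A ^ n * y ^ s := by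
  have hA0 : 0 < A := by linarith
  obtain ⟨t, rfl⟩ : ∃ t, x = t * y := ⟨x / y, by field_simp⟩
  have ht : 0 < t := by
    by_contra h
    push Not at h
    nlinarith
  have htA : t ≤ A := le_of_mul_le_mul_right h1 hy
  have htA' : 1 / A ≤ t := by
    rw [div_le_iff₀ hA0]
    by_contra h
    push Not at h
    nlinarith
  rw [Real.mul_rpow ht.le hy.le]
  refine mul_le_mul_of_nonneg_right ?_ (by positivity)
  rw [← Real.rpow_natCast]
  refine le_trans ?_ (Real.rpow_le_rpow_of_exponent_le hA hn)
  rcases le_total 0 s with h | h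
  · rw [abs_of_nonneg h]
    exact Real.rpow_le_rpow ht.le htA h
  · rw [abs_of_nonpos h]
    calc t ^ s ≤ (1 / A) ^ s := Real.rpow_le_rpow_of_nonpos (by positivity) htA' h
      _ = A ^ (-s) := by rw [one_div, Real.inv_rpow hA0.le, Real.rpow_neg hA0.le]

/-- weighted integral -/
noncomputable def J {d : ℕ} (γ : Fin d → ℝ) (S : Set ℝ) : ENNReal :=
  ∫⁻ z in psh d S, ENNReal.ofReal ((∏ i, z i ^ γ i) * Real.exp (-∑ i, z i ^ 2))

lemma J_mono {d : ℕ} (γ : Fin d → ℝ) {S T : Set ℝ} (h : S ⊆ T) : J γ S ≤ J γ T :=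
  lintegral_mono_set fun _ hz => ⟨hz.1, h hz.2⟩

lemma nrm_sq {d : ℕ} (z : Fin d → ℝ) : ∑ i, z i ^ 2 = nrm z ^ 2 := by
  unfold nrm; rw [Real.sq_sqrt (Finset.sum_nonneg fun i _ => sq_nonneg _)]

lemma J_bounds {d : ℕ} (γ : Fin d → ℝ) (hγ : ∀ i, -1 < γ i) {s : ℝ}
    (hs : (∑ i, γ i) + d = s + 1) (hp : 0 < s + 1) :
    ∃ C₁ C₂ : ℝ, 0 < C₁ ∧ 0 < C₂ ∧ ∀ a b, 0 ≤ a → a ≤ b → 0 < b →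
      ENNReal.ofReal (C₁ * ((b - a) * b ^ s * Real.exp (-b ^ 2))) ≤ J γ (Set.Icc a b) ∧
      J γ (Set.Icc a b) ≤ ENNReal.ofReal (C₂ * ((b - a) * b ^ s * Real.exp (-a ^ 2))) := by
  obtain ⟨G, hG, h⟩ := shell γ hγ (hs ▸ hp)
  rw [hs] at h
  refine ⟨G * min 1 (s + 1), G * max 1 (s + 1), by positivity, by positivity, ?_⟩
  intro a b ha hab hb
  have hd := diff_rpow hp ha hab hb
  rw [add_sub_cancel_right] at hd
  have hI := h a b ha hab hb
  constructor
  · calc _ ≤ ENNReal.ofReal (Real.exp (-b ^ 2)) * ∫⁻ z in psh d (Set.Icc a b), wt γ z := by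
          rw [hI, ← ENNReal.ofReal_mul (Real.exp_nonneg _)]
          apply ENNReal.ofReal_le_ofReal
          have : 0 ≤ G * Real.exp (-b ^ 2) := by positivity
          nlinarith [mul_le_mul_of_nonneg_left hd.1 this]
      _ = ∫⁻ z in psh d (Set.Icc a b), ENNReal.ofReal (Real.exp (-b ^ 2)) * wt γ z :=
          (lintegral_const_mul _ (wt_meas γ)).symm
      _ ≤ _ := by
          refine setLIntegral_mono' (psh_meas measurableSet_Icc) fun z hz => ?_
          unfold wt
          rw [← ENNReal.ofReal_mul (Real.exp_nonneg _), mul_comm, nrm_sq]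
          apply ENNReal.ofReal_le_ofReal
          refine mul_le_mul_of_nonneg_left ?_ (Finset.prod_nonneg fun i _ => Real.rpow_nonneg (hz.1 i).le _)
          have := pow_le_pow_left₀ (nrm_nonneg z) hz.2.2 2
          exact Real.exp_le_exp.2 (by linarith)
  · calc J γ (Set.Icc a b) ≤ ∫⁻ z in psh d (Set.Icc a b), ENNReal.ofReal (Real.exp (-a ^ 2)) * wt γ z := by
          refine setLIntegral_mono' (psh_meas measurableSet_Icc) fun z hz => ?_
          unfold wt
          rw [← ENNReal.ofReal_mul (Real.exp_nonneg _), mul_comm (Real.exp _), nrm_sq]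
          apply ENNReal.ofReal_le_ofReal
          refine mul_le_mul_of_nonneg_left ?_ (Finset.prod_nonneg fun i _ => Real.rpow_nonneg (hz.1 i).le _)
          have := pow_le_pow_left₀ ha hz.2.1 2
          exact Real.exp_le_exp.2 (by linarith)
      _ = ENNReal.ofReal (Real.exp (-a ^ 2)) * ∫⁻ z in psh d (Set.Icc a b), wt γ z :=
          (lintegral_const_mul _ (wt_meas γ))
      _ ≤ _ := by
          rw [hI, ← ENNReal.ofReal_mul (Real.exp_nonneg _)]
          apply ENNReal.ofReal_le_ofReal
          have : 0 ≤ G * Real.exp (-a ^ 2) := by positivity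
          nlinarith [mul_le_mul_of_nonneg_left hd.2 this]

lemma J_inf {d : ℕ} (γ : Fin d → ℝ) {s C₂ : ℝ} {n : ℕ} (hn : |s| ≤ n) (hC : 0 < C₂)
    (h : ∀ a b, 0 ≤ a → a ≤ b → 0 < b →
      J γ (Set.Icc a b) ≤ ENNReal.ofReal (C₂ * ((b - a) * b ^ s * Real.exp (-a ^ 2)))) :
    ∃ C₃ : ℝ, 0 < C₃ ∧ ∀ a, 0 ≤ a → J γ (Set.Ici a) ≤
      ENNReal.ofReal (C₃ * (1 / (a + 1) * (a + 1) ^ s * Real.exp (-a ^ 2))) := by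
  set u : ℕ → ℝ := fun k => (2 * ((k:ℝ) + 1)) ^ n * Real.exp (-(1/2) * k) with hu
  have hu0 : ∀ k, 0 ≤ u k := fun k => by positivity
  have hus : Summable u := by
    have h1 := (summable_nat_add_iff 1).2 (Real.summable_pow_mul_exp_neg_nat_mul n (r := 1/2) (by norm_num))
    refine (h1.mul_left (2 ^ n * Real.exp (1/2))).congr fun k => ?_
    simp only [hu]
    push_cast
    rw [mul_pow, show -(1/2 : ℝ) * k = 1/2 + -(1/2) * (k + 1) by ring, Real.exp_add]
    ring
  have hupos : 0 < ∑' k, u k := hus.tsum_pos hu0 0 (by simp only [hu]; positivity)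
  refine ⟨C₂ * ∑' k, u k, by positivity, ?_⟩
  intro a ha
  set δ := 1 / (a + 1) with hδ
  have hδ0 : 0 < δ := by positivity
  have hδa : δ * (a + 1) = 1 := by rw [hδ]; field_simp
  have hδ1 : δ ≤ 1 := by nlinarith
  set M := δ * (a + 1) ^ s * Real.exp (-a ^ 2) with hM
  have hM0 : 0 ≤ M := by positivity
  have hterm : ∀ k : ℕ, J γ (Set.Icc (a + k * δ) (a + (k + 1) * δ)) ≤ ENNReal.ofReal (C₂ * u k * M) := by
    intro k
    have hk : (0:ℝ) ≤ k := by positivity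
    refine (h _ _ (by positivity) (by nlinarith) (by positivity)).trans ?_
    apply ENNReal.ofReal_le_ofReal
    rw [mul_assoc C₂ (u k) M]
    refine mul_le_mul_of_nonneg_left ?_ hC.le
    have hb : (a + (k + 1) * δ) ^ s ≤ (2 * ((k:ℝ) + 1)) ^ n * (a + 1) ^ s := by
      apply cmp_rpow hn (by linarith) (by positivity) (by positivity)
      · nlinarith [mul_nonneg hk ha, mul_nonneg hk hδ0.le]
      · have : a + 1 ≤ 2 * (a + δ) := by
          nlinarith [sq_nonneg (δ - 1), mul_nonneg ha hδ0.le, mul_nonneg ha ha]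
        nlinarith [mul_nonneg hk ha, mul_nonneg hk hδ0.le, mul_nonneg hk (mul_nonneg hk hδ0.le)]
    have he : Real.exp (-(a + k * δ) ^ 2) ≤ Real.exp (-(1/2) * k) * Real.exp (-a ^ 2) := by
      rw [← Real.exp_add]
      apply Real.exp_le_exp.2
      have hkk : (k:ℝ) ≤ k ^ 2 := by
        exact_mod_cast Nat.le_self_pow two_ne_zero k
      have h1 : a * δ = 1 - δ := by linarith
      have h2 : 1 / 2 ≤ 2 * (a * δ) + δ ^ 2 := by rw [h1]; nlinarith [sq_nonneg (δ - 1)]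
      nlinarith [mul_le_mul_of_nonneg_left h2 hk, mul_le_mul_of_nonneg_right hkk (sq_nonneg δ)]
    calc (a + (k + 1) * δ - (a + k * δ)) * (a + (k + 1) * δ) ^ s * Real.exp (-(a + k * δ) ^ 2)
        = δ * (a + (k + 1) * δ) ^ s * Real.exp (-(a + k * δ) ^ 2) := by ring
      _ ≤ δ * ((2 * ((k:ℝ) + 1)) ^ n * (a + 1) ^ s) * (Real.exp (-(1/2) * k) * Real.exp (-a ^ 2)) := by
          gcongr
      _ = u k * M := by simp only [hu, hM]; ring
  have hcov : psh d (Set.Ici a) ⊆ ⋃ k : ℕ, psh d (Set.Icc (a + k * δ) (a + (k + 1) * δ)) := by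
    intro z hz
    have hza : a ≤ nrm z := hz.2
    rw [Set.mem_iUnion]
    have h0 : 0 ≤ (nrm z - a) / δ := div_nonneg (by linarith) hδ0.le
    refine ⟨⌊(nrm z - a) / δ⌋₊, hz.1, ?_, ?_⟩
    · have := Nat.floor_le h0
      rw [le_div_iff₀ hδ0] at this
      linarith
    · have := (Nat.lt_floor_add_one ((nrm z - a) / δ)).le
      rw [div_le_iff₀ hδ0] at this
      linarith
  calc J γ (Set.Ici a) ≤ ∑' k : ℕ, J γ (Set.Icc (a + k * δ) (a + (k + 1) * δ)) :=
        (lintegral_mono_set hcov).trans (lintegral_iUnion_le _ _)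
    _ ≤ ∑' k, ENNReal.ofReal (C₂ * u k * M) := ENNReal.tsum_le_tsum hterm
    _ = ENNReal.ofReal (∑' k, C₂ * u k * M) :=
        (ENNReal.ofReal_tsum_of_nonneg (fun k => by have := hu0 k; positivity)
          ((hus.mul_left _).mul_right _)).symm
    _ = _ := by rw [tsum_mul_right, tsum_mul_left]

lemma final {d : ℕ} (γ : Fin d → ℝ) (hγ : ∀ i, -1 < γ i) {s : ℝ}
    (hs : (∑ i, γ i) + d = s + 1) (hp : 0 < s + 1) :
    ∃ c₁ c₂ : ℝ, 0 < c₁ ∧ c₁ ≤ c₂ ∧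
      (∀ a b : ℝ, 0 ≤ a → a ≤ b →
        ENNReal.ofReal (c₁ * (min (b - a) (1 / (a + 1)) * (min b (a + 1)) ^ s * Real.exp (-a ^ 2))) ≤
          J γ (Set.Icc a b) ∧
        J γ (Set.Icc a b) ≤
          ENNReal.ofReal (c₂ * (min (b - a) (1 / (a + 1)) * (min b (a + 1)) ^ s * Real.exp (-a ^ 2)))) ∧
      (∀ a : ℝ, 0 ≤ a →
        ENNReal.ofReal (c₁ * (1 / (a + 1) * (a + 1) ^ s * Real.exp (-a ^ 2))) ≤ J γ (Set.Ici a) ∧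
        J γ (Set.Ici a) ≤
          ENNReal.ofReal (c₂ * (1 / (a + 1) * (a + 1) ^ s * Real.exp (-a ^ 2)))) := by
  obtain ⟨C₁, C₂, hC₁, hC₂, hJ⟩ := J_bounds γ hγ hs hp
  obtain ⟨n, hn⟩ := exists_nat_ge |s|
  obtain ⟨C₃, hC₃, hJ3⟩ := J_inf γ hn hC₂ (fun a b h1 h2 h3 => (hJ a b h1 h2 h3).2)
  set c₁ := C₁ * Real.exp (-3) / 2 ^ n with hc₁
  have hc₁0 : 0 < c₁ := by positivity
  set c₂ := c₁ + C₂ + 2 ^ n * C₃ with hc₂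
  have h2C : C₃ ≤ 2 ^ n * C₃ := by
    have : (1:ℝ) ≤ 2 ^ n := one_le_pow₀ (by norm_num)
    nlinarith
  have main : ∀ a b : ℝ, 0 ≤ a → a ≤ b →
        ENNReal.ofReal (c₁ * (min (b - a) (1 / (a + 1)) * (min b (a + 1)) ^ s * Real.exp (-a ^ 2))) ≤
          J γ (Set.Icc a b) ∧
        J γ (Set.Icc a b) ≤
          ENNReal.ofReal (c₂ * (min (b - a) (1 / (a + 1)) * (min b (a + 1)) ^ s * Real.exp (-a ^ 2))) := by
    intro a b ha hab
    set δ := 1 / (a + 1) with hδ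
    have hδ0 : 0 < δ := by positivity
    have hδa : δ * (a + 1) = 1 := by rw [hδ]; field_simp
    have hδ1 : δ ≤ 1 := by nlinarith
    have hhalf : a + 1 ≤ 2 * (a + δ) := by
      nlinarith [sq_nonneg (δ - 1), mul_nonneg ha hδ0.le, mul_nonneg ha ha]
    rcases (ha.trans hab).eq_or_lt with hb | hb
    · obtain rfl : b = 0 := hb.symm
      obtain rfl : a = 0 := le_antisymm hab ha
      have : J γ (Set.Icc (0:ℝ) 0) = 0 := by
        have h1 : ∀ ε : ℝ, 0 < ε → J γ (Set.Icc (0:ℝ) 0) ≤ ENNReal.ofReal (C₂ * ε ^ (s + 1)) := by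
          intro ε hε
          refine (J_mono γ (Set.Icc_subset_Icc le_rfl hε.le)).trans ((hJ 0 ε le_rfl hε.le hε).2.trans ?_)
          apply le_of_eq
          congr 1
          rw [Real.rpow_add_one hε.ne']
          simp
          ring_nf
          simp
        have ht : Filter.Tendsto (fun x : ℝ => ENNReal.ofReal (C₂ * x ^ (s + 1)))
          (nhdsWithin 0 (Set.Ioi 0)) (nhds (ENNReal.ofReal (C₂ * 0 ^ (s + 1)))) := by
          apply Filter.Tendsto.mono_left _ nhdsWithin_le_nhds
          apply (ENNReal.continuous_ofReal.tendsto _).comp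
          apply Filter.Tendsto.const_mul
          exact (Real.continuousAt_rpow_const 0 _ (Or.inr hp.le)).tendsto
        have h2 := ge_of_tendsto ht (by filter_upwards [self_mem_nhdsWithin] with x hx using h1 x hx)
        rw [Real.zero_rpow hp.ne'] at h2
        simpa using h2
      rw [this]
      simp [min_eq_left hδ0.le]
    have hMp : 0 < min b (a + 1) := lt_min hb (by linarith)
    have hM0 : 0 ≤ min (b - a) δ * (min b (a + 1)) ^ s * Real.exp (-a ^ 2) := by
      have : 0 ≤ min (b - a) δ := le_min (by linarith) hδ0.le
      positivity
    constructor
    · set b' := min b (a + δ) with hb'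
      have hb'0 : 0 < b' := lt_min hb (by linarith)
      have hab' : a ≤ b' := le_min hab (by linarith)
      refine le_trans ?_ ((hJ a b' ha hab' hb'0).1.trans
        (J_mono γ (Set.Icc_subset_Icc le_rfl (min_le_left _ _))))
      apply ENNReal.ofReal_le_ofReal
      have e1 : b' - a = min (b - a) δ := by
        rw [hb', ← min_sub_sub_right]; simp
      have e2 : (min b (a + 1)) ^ s ≤ 2 ^ n * b' ^ s := by
        apply cmp_rpow hn (by norm_num) hMp hb'0
        · rw [hb']
          rcases le_total b (a + δ) with h | h
          · rw [min_eq_left h]; linarith [min_le_left b (a + 1)]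
          · rw [min_eq_right h]; linarith [min_le_right b (a + 1)]
        · have : b' ≤ min b (a + 1) := min_le_min le_rfl (by linarith)
          linarith
      have e3 : Real.exp (-3) * Real.exp (-a ^ 2) ≤ Real.exp (-b' ^ 2) := by
        rw [← Real.exp_add]
        apply Real.exp_le_exp.2
        have : b' ^ 2 ≤ (a + δ) ^ 2 := pow_le_pow_left₀ hb'0.le (min_le_right _ _) 2
        nlinarith
      rw [e1]
      have hm : 0 ≤ min (b - a) δ := le_min (by linarith) hδ0.le
      calc c₁ * (min (b - a) δ * (min b (a + 1)) ^ s * Real.exp (-a ^ 2))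
          ≤ c₁ * (min (b - a) δ * (2 ^ n * b' ^ s) * Real.exp (-a ^ 2)) := by gcongr
        _ = C₁ * (min (b - a) δ * b' ^ s * (Real.exp (-3) * Real.exp (-a ^ 2))) := by
            rw [hc₁]; field_simp
        _ ≤ _ := by gcongr
    · rcases le_total (b - a) δ with h | h
      · refine (hJ a b ha hab hb).2.trans ?_
        apply ENNReal.ofReal_le_ofReal
        rw [min_eq_left h, min_eq_left (by linarith : b ≤ a + 1)] at *
        exact mul_le_mul_of_nonneg_right (by rw [hc₂]; nlinarith) hM0
      · refine (J_mono γ (Set.Icc_subset_Ici_self)).trans ((hJ3 a ha).trans ?_)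
        apply ENNReal.ofReal_le_ofReal
        have e2 : (a + 1) ^ s ≤ 2 ^ n * (min b (a + 1)) ^ s := by
          apply cmp_rpow hn (by norm_num) (by linarith) hMp
          · rcases le_total b (a + 1) with h | h
            · rw [min_eq_left h]; linarith
            · rw [min_eq_right h]; linarith
          · linarith [min_le_right b (a + 1)]
        calc C₃ * (δ * (a + 1) ^ s * Real.exp (-a ^ 2))
            ≤ C₃ * (δ * (2 ^ n * (min b (a + 1)) ^ s) * Real.exp (-a ^ 2)) := by gcongr
          _ = 2 ^ n * C₃ * (min (b - a) δ * (min b (a + 1)) ^ s * Real.exp (-a ^ 2)) := by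
              rw [min_eq_right h]; ring
          _ ≤ _ := mul_le_mul_of_nonneg_right (by rw [hc₂]; linarith) hM0
  refine ⟨c₁, c₂, hc₁0, by rw [hc₂]; nlinarith, main, ?_⟩
  intro a ha
  constructor
  · have h1 : 1 / (a + 1) ≤ 1 := by rw [div_le_one (by linarith)]; linarith
    have h := (main a (a + 1) ha (by linarith)).1
    rw [min_self, add_sub_cancel_left, min_eq_right h1] at h
    exact h.trans (J_mono γ Set.Icc_subset_Ici_self)
  · refine (hJ3 a ha).trans (ENNReal.ofReal_le_ofReal ?_)
    exact mul_le_mul_of_nonneg_right (by rw [hc₂]; linarith) (by positivity)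



/-- For fixed `d ≥ 2` and `γ ∈ (−1,∞)^d` there exist `0 < c₁ ≤ c₂` such that
for all `0 ≤ a ≤ b ≤ ∞`,
`c₁ M ≤ ∫_{{z ∈ (0,∞)^d : a ≤ |z| ≤ b}} z^γ e^{−|z|²} dz ≤ c₂ M`, where
`M = min(b − a, 1/(a+1)) · (min(b, a+1))^{⟨γ⟩ + d − 1} · e^{−a²}`
(for `b = ∞`, `M = (1/(a+1))(a+1)^{⟨γ⟩+d−1} e^{−a²}`), `|z|` being the Euclidean norm. -/
theorem stmt5 (d : ℕ) (hd : 2 ≤ d) (γ : Fin d → ℝ) (hγ : ∀ i, -1 < γ i) :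
    ∃ c₁ c₂ : ℝ, 0 < c₁ ∧ c₁ ≤ c₂ ∧
      (∀ a b : ℝ, 0 ≤ a → a ≤ b →
        ENNReal.ofReal (c₁ * (min (b - a) (1 / (a + 1)) *
            (min b (a + 1)) ^ ((∑ i, γ i) + d - 1) * Real.exp (-a ^ 2))) ≤
          (∫⁻ z in {z : Fin d → ℝ | (∀ i, 0 < z i) ∧
              a ≤ Real.sqrt (∑ i, z i ^ 2) ∧ Real.sqrt (∑ i, z i ^ 2) ≤ b},
            ENNReal.ofReal ((∏ i, z i ^ γ i) * Real.exp (-∑ i, z i ^ 2))) ∧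
        (∫⁻ z in {z : Fin d → ℝ | (∀ i, 0 < z i) ∧
            a ≤ Real.sqrt (∑ i, z i ^ 2) ∧ Real.sqrt (∑ i, z i ^ 2) ≤ b},
          ENNReal.ofReal ((∏ i, z i ^ γ i) * Real.exp (-∑ i, z i ^ 2))) ≤
          ENNReal.ofReal (c₂ * (min (b - a) (1 / (a + 1)) *
            (min b (a + 1)) ^ ((∑ i, γ i) + d - 1) * Real.exp (-a ^ 2)))) ∧
      (∀ a : ℝ, 0 ≤ a →
        ENNReal.ofReal (c₁ * (1 / (a + 1) *
            (a + 1) ^ ((∑ i, γ i) + d - 1) * Real.exp (-a ^ 2))) ≤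
          (∫⁻ z in {z : Fin d → ℝ | (∀ i, 0 < z i) ∧ a ≤ Real.sqrt (∑ i, z i ^ 2)},
            ENNReal.ofReal ((∏ i, z i ^ γ i) * Real.exp (-∑ i, z i ^ 2))) ∧
        (∫⁻ z in {z : Fin d → ℝ | (∀ i, 0 < z i) ∧ a ≤ Real.sqrt (∑ i, z i ^ 2)},
          ENNReal.ofReal ((∏ i, z i ^ γ i) * Real.exp (-∑ i, z i ^ 2))) ≤
          ENNReal.ofReal (c₂ * (1 / (a + 1) *
            (a + 1) ^ ((∑ i, γ i) + d - 1) * Real.exp (-a ^ 2)))) := by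
  have hsum : -(d:ℝ) < ∑ i, γ i := by
    have h := Finset.sum_lt_sum_of_nonempty (s := (Finset.univ : Finset (Fin d)))
      (f := fun _ => (-1:ℝ)) (g := γ) ⟨⟨0, by omega⟩, Finset.mem_univ _⟩ (fun i _ => hγ i)
    simpa using h
  exact final γ hγ (s := (∑ i, γ i) + d - 1) (by ring) (by linarith)
end
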